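/- arXiv:2406.09210 — 4 statements merged into one kernel-verified Lean document; each statement's English description precedes it below -/
import Mathlib

section
/- For any positive integer n >= 2, the dicyclic group Q_{4n} satisfies f(Q_{4n}) = e(Q_{4n}) = 2n, where d(Q_{4n}) = 2n + 1. -/
open List Subgroup

/-- The set of all products of the terms of `S` in all orders. -/
def PiSet {G : Type*} [Group G] (S : List G) : Set G :=
  {g | ∃ l : List G, l.Perm S ∧ l.prod = g}

/-- `S` is a product-one sequence if `1 ∈ Π(S)`. -/
def IsProdOne {G : Type*} [Group G] (S : List G) : Prop :=
  (1 : G) ∈ PiSet S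

/-- The Davenport constant `d(G)`: the smallest `m` such that every sequence of
length `m` over `G` contains a nonempty product-one subsequence. -/
noncomputable def dC (G : Type*) [Group G] : ℕ :=
  sInf {m | 0 < m ∧ ∀ S : List G, S.length = m →
    ∃ T : List G, T ≠ [] ∧ T.Sublist S ∧ IsProdOne T}

/-- `e(G)`: the smallest `m` such that every nonempty product-one sequence over `G`
contains a nonempty product-one subsequence of length at most `m`. -/
noncomputable def eC (G : Type*) [Group G] : ℕ :=
  sInf {m | 0 < m ∧ ∀ S : List G, S ≠ [] → IsProdOne S →
    ∃ T : List G, T ≠ [] ∧ T.Sublist S ∧ T.length ≤ m ∧ IsProdOne T}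

/-- `f(G)`: the smallest `m` such that every sequence of length `d(G)` over `G`
contains a nonempty product-one subsequence of length at most `m`. -/
noncomputable def fC (G : Type*) [Group G] : ℕ :=
  sInf {m | 0 < m ∧ ∀ S : List G, S.length = dC G →
    ∃ T : List G, T ≠ [] ∧ T.Sublist S ∧ T.length ≤ m ∧ IsProdOne T}

/-- The `k`-th Davenport constant `d_k(G)`: the smallest `m` such that every sequence of
length `m` over `G` contains `k` pairwise disjoint nonempty product-one subsequences. -/
noncomputable def dkC (G : Type*) [Group G] (k : ℕ) : ℕ :=
  sInf {m | 0 < m ∧ ∀ S : List G, S.length = m →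
    ∃ Ts : List (List G), Ts.length = k ∧ (∀ T ∈ Ts, T ≠ [] ∧ IsProdOne T) ∧
      (Ts.flatten : Multiset G) ≤ (S : Multiset G)}

namespace DicyclicSequences

/-- The union of the translates of `X` by all subset sums of a list, the empty sum included. -/
def translates {M : Type*} [AddCommGroup M] [DecidableEq M] (X : Finset M) : List M → Finset M
  | [] => X
  | d :: L => translates X L ∪ (translates X L).image (d + ·)

/-- The set of all subset sums of a list, the empty sum included. -/
def subsetSums {M : Type*} [AddCommGroup M] [DecidableEq M] (L : List M) : Finset M :=
  translates {0} L

section SubsetSums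

variable {M : Type*} [AddCommGroup M] [DecidableEq M]

lemma mem_translates_cons {X : Finset M} {d : M} {L : List M} {x : M} :
    x ∈ translates X (d :: L) ↔ x ∈ translates X L ∨ ∃ y ∈ translates X L, d + y = x := by
  simp only [translates, Finset.mem_union, Finset.mem_image]

lemma exists_sublist_of_mem_subsetSums {L : List M} {x : M} (hx : x ∈ subsetSums L) :
    ∃ T : List M, T.Sublist L ∧ T.sum = x := by
  induction L generalizing x with
  | nil => exact ⟨[], .slnil, by simpa [subsetSums, translates, eq_comm] using hx⟩
  | cons d L ih =>
    rcases mem_translates_cons.1 hx with h | ⟨y, h, rfl⟩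
    · obtain ⟨T, hT, rfl⟩ := ih h
      exact ⟨T, hT.cons d, rfl⟩
    · obtain ⟨T, hT, rfl⟩ := ih h
      exact ⟨d :: T, hT.cons_cons d, by simp⟩

lemma zero_mem_subsetSums (L : List M) : (0 : M) ∈ subsetSums L := by
  induction L with
  | nil => simp [subsetSums, translates]
  | cons d L ih => exact mem_translates_cons.2 (.inl ih)

/-- A zero-sum free list has more subset sums than terms. -/
lemma length_lt_card_subsetSums [Finite M] {L : List M}
    (hL : ∀ T : List M, T ≠ [] → T.Sublist L → T.sum ≠ 0) :
    L.length < (subsetSums L).card := by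
  induction L with
  | nil => simp [subsetSums, translates]
  | cons d L ih =>
    have ih := ih fun T h0 hT => hL T h0 (hT.cons d)
    suffices h : ∃ x ∈ subsetSums L, d + x ∉ subsetSums L by
      obtain ⟨x, hx, hdx⟩ := h
      have hss : subsetSums L ⊂ subsetSums (d :: L) := by
        refine Finset.ssubset_iff_subset_ne.2 ⟨Finset.subset_union_left, fun h => hdx ?_⟩
        rw [h]
        exact mem_translates_cons.2 (.inr ⟨x, hx, rfl⟩)
      have := Finset.card_lt_card hss
      rw [List.length_cons]
      omega
    by_contra! hcl
    have hmul : ∀ m : ℕ, m • d ∈ subsetSums L := fun m => by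
      induction m with
      | zero => simpa using zero_mem_subsetSums L
      | succ m ihm => rw [succ_nsmul']; exact hcl _ ihm
    obtain ⟨T, hT, hs⟩ := exists_sublist_of_mem_subsetSums (hmul (addOrderOf d - 1))
    refine hL (d :: T) (by simp) (hT.cons_cons d) ?_
    rw [List.sum_cons, hs, ← succ_nsmul', Nat.sub_add_cancel (addOrderOf_pos d),
      addOrderOf_nsmul_eq_zero]

/-- A difference of two subset sums is a signed sum over disjoint subsequences. -/
lemma exists_signed_of_mem_subsetSums {L : List M} {x y : M} (hx : x ∈ subsetSums L)
    (hy : y ∈ subsetSums L) :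
    ∃ U V : List M, (U ++ V).Subperm L ∧ x - y = U.sum - V.sum := by
  induction L generalizing x y with
  | nil =>
    refine ⟨[], [], Subperm.refl _, ?_⟩
    simp_all [subsetSums, translates]
  | cons d L ih =>
    have hd {U V : List M} (h : (U ++ V).Subperm L) : (U ++ V).Subperm (d :: L) :=
      h.trans (sublist_cons_self d L).subperm
    rcases mem_translates_cons.1 hx with hx' | ⟨x, hx', rfl⟩ <;>
      rcases mem_translates_cons.1 hy with hy' | ⟨y, hy', rfl⟩ <;>
      obtain ⟨U, V, hUV, h⟩ := ih hx' hy'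
    · exact ⟨U, V, hd hUV, h⟩
    · refine ⟨U, d :: V, ?_, ?_⟩
      · exact perm_middle.subperm.trans ((subperm_cons d).2 hUV)
      · rw [List.sum_cons, sub_add_eq_sub_sub_swap, sub_add_eq_sub_sub_swap, h]
    · refine ⟨d :: U, V, (subperm_cons d).2 hUV, ?_⟩
      rw [List.sum_cons, add_sub_assoc, add_sub_assoc, h]
    · exact ⟨U, V, hd hUV, by rw [← h]; abel⟩

end SubsetSums

variable {n : ℕ}

open QuaternionGroup

/-- The exponent `n + q - p` of the product of `xa p` and `xa q`. -/
def pairExp (p : ZMod (2 * n) × ZMod (2 * n)) : ZMod (2 * n) := n + p.2 - p.1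

/-- The sequence `xa p, xa q, …` over all pairs `(p, q)` in a list. -/
def pairSeq (P : List (ZMod (2 * n) × ZMod (2 * n))) : List (QuaternionGroup n) :=
  P.flatMap fun p => [xa p.1, xa p.2]

lemma pairSeq_cons (p : ZMod (2 * n) × ZMod (2 * n)) (P : List (ZMod (2 * n) × ZMod (2 * n))) :
    pairSeq (p :: P) = xa p.1 :: xa p.2 :: pairSeq P := rfl

lemma length_pairSeq (P : List (ZMod (2 * n) × ZMod (2 * n))) :
    (pairSeq P).length = 2 * P.length := by
  induction P with
  | nil => rfl
  | cons p P ih => rw [pairSeq_cons]; simp [ih]; ring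

lemma pairExp_swap (p : ZMod (2 * n) × ZMod (2 * n)) : pairExp p.swap = -pairExp p := by
  have h : ((2 * n : ℕ) : ZMod (2 * n)) = 0 := ZMod.natCast_self _
  push_cast at h
  simp only [pairExp, Prod.fst_swap, Prod.snd_swap]
  linear_combination h

lemma prod_map_a (L : List (ZMod (2 * n))) : (L.map (a : _ → QuaternionGroup n)).prod = a L.sum := by
  induction L with
  | nil => rfl
  | cons d L ih => simp [ih, a_mul_a]

lemma prod_pairSeq (P : List (ZMod (2 * n) × ZMod (2 * n))) :
    (pairSeq P).prod = a (P.map pairExp).sum := by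
  induction P with
  | nil => rfl
  | cons p P ih =>
    rw [pairSeq_cons, List.prod_cons, List.prod_cons, ← mul_assoc, xa_mul_xa, ih, a_mul_a,
      List.map_cons, List.sum_cons, pairExp]

lemma isProdOne_of_perm {G : Type*} [Group G] {S T : List G} (hS : IsProdOne S) (h : S.Perm T) :
    IsProdOne T := by
  obtain ⟨l, hl, h1⟩ := hS
  exact ⟨l, hl.trans h, h1⟩

lemma isProdOne_of_signed_sum_eq_zero {U V : List (ZMod (2 * n))}
    {p : ZMod (2 * n) × ZMod (2 * n)} {P : List (ZMod (2 * n) × ZMod (2 * n))}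
    (h : U.sum - V.sum + ((p :: P).map pairExp).sum = 0) :
    IsProdOne ((U ++ V).map a ++ pairSeq (p :: P)) := by
  refine ⟨U.map a ++ xa p.1 :: (V.map a ++ xa p.2 :: pairSeq P), ?_, ?_⟩
  · rw [pairSeq_cons, List.map_append, List.append_assoc]
    refine Perm.append_left _ ?_
    refine (Perm.cons _ perm_middle).trans ?_
    exact (Perm.cons _ perm_middle.symm).trans perm_middle.symm
  · simp only [List.prod_append, List.prod_cons, prod_map_a, prod_pairSeq, a_mul_a, xa_mul_a,
      a_mul_xa, xa_mul_xa, one_def]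
    rw [List.map_cons, List.sum_cons, pairExp] at h
    congr 1
    linear_combination h

/-- A difference of two elements of the translates of the subset sums of `L` by the pair
exponents of `P` is a signed sum. -/
lemma exists_signed_of_mem_translates {L : List (ZMod (2 * n))}
    {P : List (ZMod (2 * n) × ZMod (2 * n))} {x y : ZMod (2 * n)}
    (hx : x ∈ translates (subsetSums L) (P.map pairExp))
    (hy : y ∈ translates (subsetSums L) (P.map pairExp)) :
    ∃ (U V : List (ZMod (2 * n))) (Q : List (ZMod (2 * n) × ZMod (2 * n))),
      (U ++ V).Subperm L ∧ (pairSeq Q).Subperm (pairSeq P) ∧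
        x - y = U.sum - V.sum + (Q.map pairExp).sum := by
  induction P generalizing x y with
  | nil =>
    obtain ⟨U, V, hUV, h⟩ := exists_signed_of_mem_subsetSums hx hy
    exact ⟨U, V, [], hUV, Subperm.refl _, by simpa using h⟩
  | cons p P ih =>
    have hp : (pairSeq P).Subperm (pairSeq (p :: P)) :=
      ((sublist_cons_self _ _).trans (sublist_cons_self _ _)).subperm
    rcases mem_translates_cons.1 hx with hx' | ⟨x, hx', rfl⟩ <;>
      rcases mem_translates_cons.1 hy with hy' | ⟨y, hy', rfl⟩ <;>
      obtain ⟨U, V, Q, hUV, hQ, h⟩ := ih hx' hy'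
    · exact ⟨U, V, Q, hUV, hQ.trans hp, h⟩
    · refine ⟨U, V, p.swap :: Q, hUV, ?_, ?_⟩
      · exact (Perm.swap _ _ _).subperm.trans ((subperm_cons _).2 ((subperm_cons _).2 hQ))
      · rw [List.map_cons, List.sum_cons, pairExp_swap]
        linear_combination h
    · refine ⟨U, V, p :: Q, hUV, (subperm_cons _).2 ((subperm_cons _).2 hQ), ?_⟩
      rw [List.map_cons, List.sum_cons]
      linear_combination h
    · exact ⟨U, V, Q, hUV, hQ.trans hp, by linear_combination h⟩

/-- Each pair `xa p, xa q` doubles the number of translates unless a product-one subsequence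
appears. -/
lemma card_translates {L : List (ZMod (2 * n))} {P : List (ZMod (2 * n) × ZMod (2 * n))}
    (h : ∀ T : List (QuaternionGroup n), T ≠ [] → T.Subperm (L.map a ++ pairSeq P) →
      ¬ IsProdOne T) :
    (translates (subsetSums L) (P.map pairExp)).card = 2 ^ P.length * (subsetSums L).card := by
  induction P with
  | nil => simp [translates]
  | cons p P ih =>
    have ih := ih fun T h0 hT => h T h0 (hT.trans
      (((sublist_cons_self _ _).trans (sublist_cons_self _ _)).append_left _).subperm)
    have hdisj : Disjoint (translates (subsetSums L) (P.map pairExp))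
        ((translates (subsetSums L) (P.map pairExp)).image (pairExp p + ·)) := by
      rw [Finset.disjoint_left]
      rintro y hy hy'
      obtain ⟨x, hx, rfl⟩ := Finset.mem_image.1 hy'
      obtain ⟨U, V, Q, hUV, hQ, hs⟩ := exists_signed_of_mem_translates hx hy
      refine h ((U ++ V).map a ++ pairSeq (p :: Q)) (by simp [pairSeq_cons]) ?_
        (isProdOne_of_signed_sum_eq_zero ?_)
      · exact (hUV.map fun _ _ => QuaternionGroup.a.inj).append ((subperm_cons _).2 ((subperm_cons _).2 hQ))
      · rw [List.map_cons, List.sum_cons]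
        linear_combination -hs
    rw [List.map_cons, translates, Finset.card_union_of_disjoint hdisj,
      Finset.card_image_of_injective _ (add_right_injective _), ih, List.length_cons]
    ring

lemma exists_isProdOne_of_lt [NeZero n] {L : List (ZMod (2 * n))}
    {P : List (ZMod (2 * n) × ZMod (2 * n))} (hlt : 2 * n < 2 ^ P.length * (L.length + 1)) :
    ∃ T : List (QuaternionGroup n), T ≠ [] ∧ T.Subperm (L.map a ++ pairSeq P) ∧ IsProdOne T := by
  by_contra! h
  have hL : L.length < (subsetSums L).card := by
    refine length_lt_card_subsetSums fun T h0 hT hs => ?_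
    refine h (T.map a) (by simpa using h0)
      ((hT.map a).trans (sublist_append_left _ _)).subperm ⟨_, Perm.refl _, ?_⟩
    rw [prod_map_a, hs, one_def]
  have h1 := card_translates h
  have h2 := (translates (subsetSums L) (P.map pairExp)).card_le_univ
  rw [ZMod.card, h1] at h2
  exact absurd (hlt.trans_le (Nat.mul_le_mul_left _ hL)) h2.not_gt

lemma exists_perm_map_append_map (S : List (QuaternionGroup n)) :
    ∃ L M : List (ZMod (2 * n)), S.Perm (L.map a ++ M.map xa) := by
  induction S with
  | nil => exact ⟨[], [], Perm.refl _⟩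
  | cons g S ih =>
    obtain ⟨L, M, h⟩ := ih
    cases g with
    | a i => exact ⟨i :: L, M, h.cons _⟩
    | xa i => exact ⟨L, i :: M, (h.cons _).trans perm_middle.symm⟩

lemma exists_pairSeq_sublist {k : ℕ} {M : List (ZMod (2 * n))} (hk : 2 * k ≤ M.length) :
    ∃ P : List (ZMod (2 * n) × ZMod (2 * n)), P.length = k ∧ (pairSeq P).Sublist (M.map xa) := by
  induction k generalizing M with
  | zero => exact ⟨[], rfl, nil_sublist _⟩
  | succ k ih =>
    match M, hk with
    | [], hk => simp at hk
    | [_], hk => simp at hk; omega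
    | p :: q :: M, hk =>
      obtain ⟨P, hP, h⟩ := ih (M := M) (by simp at hk; omega)
      exact ⟨(p, q) :: P, by simp [hP], (h.cons_cons _).cons_cons _⟩

lemma two_mul_lt_two_pow_mul {n k : ℕ} (hn : 2 ≤ n) (hk : k ≤ n) (h : ¬ (n = 2 ∧ k = 2)) :
    2 * n < 2 ^ k * (2 * n - 2 * k + 1) := by
  obtain ⟨j, rfl⟩ := Nat.exists_eq_add_of_le hk
  have e : 2 * (k + j) - 2 * k = 2 * j := by omega
  rw [e]
  have h3 : ∀ m, 3 ≤ m → 2 * m < 2 ^ m := fun m hm => by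
    induction m, hm using Nat.le_induction with
    | base => norm_num
    | succ m hm ih => rw [pow_succ]; omega
  rcases Nat.lt_or_ge k 3 with hk3 | hk3
  · interval_cases k <;> omega
  · nlinarith [h3 k hk3]

lemma exists_prod_eq_one_quaternionGroup_two (y₁ y₂ y₃ y₄ : ZMod (2 * 2))
    (z : QuaternionGroup 2) :
    ∃ T ∈ [xa y₁, xa y₂, xa y₃, xa y₄, z].sublists, T ≠ [] ∧ T.length ≤ 4 ∧
      ∃ l ∈ T.permutations', l.prod = 1 := by
  revert y₁ y₂ y₃ y₄ z
  decide +kernel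

/-- Every sequence of length `2n + 1` has a product-one subsequence of length at most `2n`. -/
lemma exists_short_isProdOne (hn : 2 ≤ n) {S : List (QuaternionGroup n)}
    (hS : S.length = 2 * n + 1) :
    ∃ T : List (QuaternionGroup n), T ≠ [] ∧ T.Sublist S ∧ T.length ≤ 2 * n ∧ IsProdOne T := by
  suffices h : ∃ T : List (QuaternionGroup n), T ≠ [] ∧ T.Subperm S ∧ T.length ≤ 2 * n ∧
      IsProdOne T by
    obtain ⟨T, h0, ⟨T', hT', hs⟩, hl, h1⟩ := h
    exact ⟨T', fun h => h0 (by simpa [h] using hT'), hs, hT'.length_eq ▸ hl,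
      isProdOne_of_perm h1 hT'.symm⟩
  have : NeZero n := ⟨by omega⟩
  obtain ⟨L, M, hperm⟩ := exists_perm_map_append_map S
  have hlen : L.length + M.length = 2 * n + 1 := by simpa [hS] using hperm.length_eq.symm
  by_cases hex : n = 2 ∧ M.length / 2 = 2
  · obtain ⟨rfl, hM⟩ := hex
    obtain ⟨y₁, y₂, y₃, y₄, z, hz⟩ : ∃ y₁ y₂ y₃ y₄ z,
        S.Perm [xa y₁, xa y₂, xa y₃, xa y₄, z] := by
      obtain ⟨h5, h0⟩ | ⟨h4, h1⟩ :
          M.length = 5 ∧ L.length = 0 ∨ M.length = 4 ∧ L.length = 1 := by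
        omega
      · match L, M, h5, h0 with
        | [], [y₁, y₂, y₃, y₄, z], _, _ => exact ⟨y₁, y₂, y₃, y₄, xa z, hperm⟩
      · match L, M, h4, h1 with
        | [z], [y₁, y₂, y₃, y₄], _, _ =>
          exact ⟨y₁, y₂, y₃, y₄, a z, hperm.trans (perm_append_comm (l₁ := [a z]))⟩
    obtain ⟨T, hT, h0, hl, l, hl', h1⟩ := exists_prod_eq_one_quaternionGroup_two y₁ y₂ y₃ y₄ z
    exact ⟨T, h0, (mem_sublists.1 hT).subperm.trans hz.symm.subperm, hl, l,
      mem_permutations'.1 hl', h1⟩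
  · obtain ⟨P, hP, hPM⟩ := exists_pairSeq_sublist (k := M.length / 2) (M := M) (by omega)
    have hL : (L.take (2 * n - 2 * (M.length / 2))).length = 2 * n - 2 * (M.length / 2) := by
      rw [List.length_take]; omega
    obtain ⟨T, h0, hT, h1⟩ := exists_isProdOne_of_lt
      (L := L.take (2 * n - 2 * (M.length / 2))) (P := P)
      (by rw [hP, hL]; exact two_mul_lt_two_pow_mul hn (by omega) hex)
    refine ⟨T, h0, hT.trans ?_, ?_, h1⟩
    · exact (((take_sublist _ _).map a).append hPM).subperm.trans hperm.symm.subperm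
    · have := hT.length_le
      rw [List.length_append, List.length_map, hL, length_pairSeq, hP] at this
      omega

/-- The character of the dicyclic group whose kernel is the cyclic subgroup generated by `a 1`. -/
def signHom (n : ℕ) : QuaternionGroup n →* ℤˣ where
  toFun
    | a _ => 1
    | xa _ => -1
  map_one' := rfl
  map_mul' := by rintro (i | i) (j | j) <;> rfl

lemma two_mul_le_length {m : ℕ} {T : List (QuaternionGroup n)} (h0 : T ≠ [])
    (hT : T.Sublist (replicate m (a 1) ++ [xa 0])) (h1 : IsProdOne T) :
    2 * n ≤ T.length ∧ T.length ≤ m := by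
  obtain ⟨T₁, T₂, rfl, hT₁, hT₂⟩ := sublist_append_iff.1 hT
  obtain ⟨j, hj, rfl⟩ := sublist_replicate_iff.1 hT₁
  obtain ⟨l, hl, hl1⟩ := h1
  rcases sublist_singleton.1 hT₂ with rfl | rfl
  · rw [List.append_nil] at hl h0 ⊢
    rw [perm_replicate.1 hl, prod_replicate, a_one_pow, one_def, a.injEq,
      ZMod.natCast_eq_zero_iff] at hl1
    rw [length_replicate]
    exact ⟨Nat.le_of_dvd (Nat.pos_of_ne_zero fun h => h0 (by simp [h])) hl1, hj⟩
  · have h := congrArg (signHom n) hl1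
    rw [map_list_prod, (hl.map _).prod_eq] at h
    have ha : signHom n (a 1) = 1 := rfl
    have hxa : signHom n (xa 0) = -1 := rfl
    simp [ha, hxa] at h

lemma dC_quaternionGroup (hn : 2 ≤ n) : dC (QuaternionGroup n) = 2 * n + 1 := by
  have hmem : 2 * n + 1 ∈ {m | 0 < m ∧ ∀ S : List (QuaternionGroup n), S.length = m →
      ∃ T : List (QuaternionGroup n), T ≠ [] ∧ T.Sublist S ∧ IsProdOne T} :=
    ⟨by omega, fun S hS =>
      let ⟨T, h0, hT, _, h1⟩ := exists_short_isProdOne hn hS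
      ⟨T, h0, hT, h1⟩⟩
  refine le_antisymm (Nat.sInf_le hmem) (le_csInf ⟨_, hmem⟩ ?_)
  rintro m ⟨-, hm⟩
  by_contra! hlt
  obtain ⟨T, h0, hT, h1⟩ := hm ((replicate (2 * n - 1) (a 1) ++ [xa 0]).take m) (by simp; omega)
  have := two_mul_le_length h0 (hT.trans (take_sublist _ _)) h1
  omega

lemma fC_quaternionGroup (hn : 2 ≤ n) : fC (QuaternionGroup n) = 2 * n := by
  rw [fC, dC_quaternionGroup hn]
  have hmem : 2 * n ∈ {m | 0 < m ∧ ∀ S : List (QuaternionGroup n), S.length = 2 * n + 1 →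
      ∃ T : List (QuaternionGroup n), T ≠ [] ∧ T.Sublist S ∧ T.length ≤ m ∧ IsProdOne T} :=
    ⟨by omega, fun S hS => exists_short_isProdOne hn hS⟩
  refine le_antisymm (Nat.sInf_le hmem) (le_csInf ⟨_, hmem⟩ ?_)
  rintro m ⟨-, hm⟩
  obtain ⟨T, h0, hT, hl, h1⟩ := hm (replicate (2 * n) (a 1) ++ [xa 0]) (by simp)
  exact (two_mul_le_length h0 hT h1).1.trans hl

lemma eC_quaternionGroup (hn : 2 ≤ n) : eC (QuaternionGroup n) = 2 * n := by
  have hmem : 2 * n ∈ {m | 0 < m ∧ ∀ S : List (QuaternionGroup n), S ≠ [] → IsProdOne S →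
      ∃ T : List (QuaternionGroup n), T ≠ [] ∧ T.Sublist S ∧ T.length ≤ m ∧ IsProdOne T} := by
    refine ⟨by omega, fun S h0 h1 => ?_⟩
    rcases le_or_gt S.length (2 * n) with h | h
    · exact ⟨S, h0, Sublist.refl S, h, h1⟩
    · obtain ⟨T, hT0, hT, hl, hT1⟩ := exists_short_isProdOne hn (S := S.take (2 * n + 1))
        (by rw [List.length_take]; omega)
      exact ⟨T, hT0, hT.trans (take_sublist _ _), hl, hT1⟩
  refine le_antisymm (Nat.sInf_le hmem) (le_csInf ⟨_, hmem⟩ ?_)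
  rintro m ⟨-, hm⟩
  obtain ⟨T, h0, hT, hl, h1⟩ := hm (replicate (2 * n) (a 1))
    (by simp; omega) ⟨_, Perm.refl _, by
      rw [prod_replicate, a_one_pow, ZMod.natCast_self, one_def]⟩
  exact (two_mul_le_length h0 (hT.trans (sublist_append_left _ _)) h1).1.trans hl

end DicyclicSequences

/-- For `n ≥ 2`, `f(Q_{4n}) = e(Q_{4n}) = 2n`, where `d(Q_{4n}) = 2n + 1`. -/
theorem dicyclic_f_e (n : ℕ) (hn : 2 ≤ n) :
    fC (QuaternionGroup n) = 2 * n ∧ eC (QuaternionGroup n) = 2 * n ∧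
      dC (QuaternionGroup n) = 2 * n + 1 :=
  ⟨DicyclicSequences.fC_quaternionGroup hn, DicyclicSequences.eC_quaternionGroup hn,
    DicyclicSequences.dC_quaternionGroup hn⟩
end

section
/- Let G = <x, y | x^q = y^n = 1, x^g y = y x> with q prime and ord_q(g) = n, and let H = <x>. If S is a nonempty sequence over G that is minimal with respect to the property that Pi(S) meets H (no proper nonempty subsequence has product set meeting H), then Pi(S) is contained in H, and either 1 is in Pi(S) or |Pi(S)| >= |S|. -/
open List Subgroup

section Metacyclic

variable {G : Type*} [Group G]

theorem prod_mem_PiSet_self (S : List G) : S.prod ∈ PiSet S := ⟨S, Perm.refl S, rfl⟩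

theorem prod_rotate_eq_conj (S : List G) {i : ℕ} (hi : i ≤ S.length) :
    (S.rotate i).prod = (S.take i).prod⁻¹ * S.prod * (S.take i).prod := by
  rw [rotate_eq_drop_append_take hi, prod_append, ← S.prod_take_mul_prod_drop i,
    inv_mul_cancel_left]

theorem pow_mul_eq_of_rel {x y : G} {g : ℕ} (hrel : x ^ g * y = y * x) (b : ℕ) :
    y ^ b * x * (y ^ b)⁻¹ = x ^ g ^ b := by
  have hconj : y * x * y⁻¹ = x ^ g := by rw [← hrel, mul_inv_cancel_right]
  induction b with
  | zero => simp
  | succ b ih =>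
    calc y ^ (b + 1) * x * (y ^ (b + 1))⁻¹ = y * (y ^ b * x * (y ^ b)⁻¹) * y⁻¹ := by
          rw [pow_succ']; group
      _ = x ^ g ^ (b + 1) := by rw [ih, ← conj_pow, hconj, ← pow_mul, pow_succ']

theorem zpowers_normal_of_rel [Finite G] {x y : G} {g : ℕ} (hrel : x ^ g * y = y * x)
    (hgen : Subgroup.closure ({x, y} : Set G) = ⊤) : (zpowers x).Normal := by
  rw [← normalizer_eq_top_iff, eq_top_iff, ← hgen, closure_le]
  have hy (b : ℕ) (h : G) (hh : h ∈ zpowers x) : y ^ b * h * (y ^ b)⁻¹ ∈ zpowers x := by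
    obtain ⟨k, rfl⟩ := mem_zpowers_iff.mp hh
    rw [← conj_zpow, pow_mul_eq_of_rel hrel]
    exact zpow_mem (pow_mem (mem_zpowers x) _) _
  rintro z (rfl | rfl)
  · exact le_normalizer (mem_zpowers z)
  · refine mem_normalizer_iff.mpr fun h => ⟨fun hh => by simpa using hy 1 h hh, fun hh => ?_⟩
    obtain ⟨m, hm⟩ := (isOfFinOrder_of_finite z).mem_powers_iff_mem_zpowers.mpr
      (inv_mem (mem_zpowers z))
    have := hy m _ hh
    simp only at hm
    rw [hm] at this
    simpa [mul_assoc] using this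

theorem exists_zpow_mul_pow [Finite G] {x y : G} (hN : (zpowers x).Normal)
    (hgen : Subgroup.closure ({x, y} : Set G) = ⊤) (c : G) :
    ∃ h ∈ zpowers x, ∃ b : ℕ, h * y ^ b = c := by
  have hc : c ∈ zpowers x ⊔ zpowers y := by
    rw [zpowers_eq_closure, zpowers_eq_closure, ← Subgroup.closure_union, Set.singleton_union, hgen]
    exact mem_top c
  obtain ⟨h, hh, z, hz, rfl⟩ := mem_sup_of_normal_left.mp hc
  obtain ⟨b, rfl⟩ := (isOfFinOrder_of_finite y).mem_powers_iff_mem_zpowers.mpr hz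
  exact ⟨h, hh, b, rfl⟩

theorem mk_commute_of_closure_pair [Finite G] {x y : G} [hN : (zpowers x).Normal]
    (hgen : Subgroup.closure ({x, y} : Set G) = ⊤) (u v : G) :
    Commute (QuotientGroup.mk' (zpowers x) u) (QuotientGroup.mk' (zpowers x) v) := by
  have key (c : G) : ∃ b : ℕ, QuotientGroup.mk' (zpowers x) c
      = QuotientGroup.mk' (zpowers x) y ^ b := by
    obtain ⟨h, hh, b, rfl⟩ := exists_zpow_mul_pow hN hgen c
    refine ⟨b, ?_⟩
    have hone : QuotientGroup.mk' (zpowers x) h = 1 := (QuotientGroup.eq_one_iff h).mpr hh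
    rw [map_mul, map_pow, hone, one_mul]
  obtain ⟨a, ha⟩ := key u
  obtain ⟨b, hb⟩ := key v
  rw [ha, hb]
  exact (Commute.refl _).pow_pow a b

theorem PiSet_subset_zpowers_of_inter_nonempty [Finite G] {x y : G} (hN : (zpowers x).Normal)
    (hgen : Subgroup.closure ({x, y} : Set G) = ⊤) {S : List G}
    (hmeet : (PiSet S ∩ (zpowers x : Set G)).Nonempty) : PiSet S ⊆ zpowers x := by
  obtain ⟨_, ⟨l, hl, rfl⟩, hlx⟩ := hmeet
  rintro _ ⟨m, hm, rfl⟩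
  have hperm : (l.map (QuotientGroup.mk' (zpowers x))).Perm
      (m.map (QuotientGroup.mk' (zpowers x))) := (hl.trans hm.symm).map _
  have hcomm : (l.map (QuotientGroup.mk' (zpowers x))).Pairwise Commute :=
    pairwise_map.mpr (pairwise_of_forall (mk_commute_of_closure_pair hgen))
  have hprod := hperm.prod_eq' hcomm
  rw [← map_list_prod, ← map_list_prod] at hprod
  have hone : QuotientGroup.mk' (zpowers x) l.prod = 1 := (QuotientGroup.eq_one_iff _).mpr hlx
  exact (QuotientGroup.eq_one_iff _).mp (hprod.symm.trans hone)

theorem mem_zpowers_of_commute [Finite G] {q n g : ℕ} (hg : orderOf (g : ZMod q) = n)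
    {x y : G} (hordx : orderOf x = q) (hordy : orderOf y = n) (hrel : x ^ g * y = y * x)
    (hgen : Subgroup.closure ({x, y} : Set G) = ⊤) {c : G} (hc : Commute c x) :
    c ∈ zpowers x := by
  obtain ⟨h, hh, b, rfl⟩ := exists_zpow_mul_pow (zpowers_normal_of_rel hrel hgen) hgen c
  have hhx : Commute h x := by
    obtain ⟨k, rfl⟩ := mem_zpowers_iff.mp hh
    exact (Commute.refl x).zpow_left k
  have hyx : Commute (y ^ b) x := by simpa using hhx.inv_left.mul_left hc
  have hpow : x ^ g ^ b = x ^ 1 := by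
    rw [← pow_mul_eq_of_rel hrel, hyx.eq, mul_inv_cancel_right, pow_one]
  have hgb : (g : ZMod q) ^ b = 1 := by
    rw [pow_eq_pow_iff_modEq, hordx] at hpow
    simpa using (ZMod.natCast_eq_natCast_iff _ _ _).mpr hpow
  have hyb : y ^ b = 1 := orderOf_dvd_iff_pow_eq_one.mp
    (hordy.trans hg.symm ▸ orderOf_dvd_of_pow_eq_one hgb)
  rwa [hyb, mul_one]

theorem mem_zpowers_of_orderOf_prime {x h : G} (hx : (orderOf x).Prime) (hh : h ∈ zpowers x)
    (h1 : h ≠ 1) : x ∈ zpowers h := by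
  have : Fact (orderOf x).Prime := ⟨hx⟩
  have hcard : Nat.card (zpowers x) = orderOf x := Nat.card_zpowers x
  have h1' : (⟨h, hh⟩ : zpowers x) ≠ 1 := fun e => h1 (congrArg Subtype.val e)
  obtain ⟨k, hk⟩ := mem_zpowers_iff.mp
    (mem_zpowers_of_prime_card hcard h1' (g' := ⟨x, mem_zpowers x⟩))
  exact mem_zpowers_iff.mpr ⟨k, congrArg Subtype.val hk⟩

theorem prod_rotate_ne_of_lt [Finite G] {q n g : ℕ} (hq : q.Prime)
    (hg : orderOf (g : ZMod q) = n) {x y : G} (hordx : orderOf x = q) (hordy : orderOf y = n)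
    (hrel : x ^ g * y = y * x) (hgen : Subgroup.closure ({x, y} : Set G) = ⊤) {S : List G}
    (hmin : ∀ T : List G, T ≠ [] → T.Sublist S → T.length < S.length →
      PiSet T ∩ (zpowers x : Set G) = ∅)
    (hSx : S.prod ∈ zpowers x) (hS1 : S.prod ≠ 1) {i j : ℕ} (hij : i < j)
    (hj : j < S.length) : (S.rotate i).prod ≠ (S.rotate j).prod := by
  intro heq
  rw [prod_rotate_eq_conj S (by lia), prod_rotate_eq_conj S (by lia)] at heq
  set T := (S.take j).drop i with hT
  have hlen : T.length = j - i := by simp [hT]; lia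
  have hsplit : (S.take j).prod = (S.take i).prod * T.prod := by
    rw [← prod_take_mul_prod_drop (S.take j) i, take_take, min_eq_left hij.le]
  set A := (S.take i).prod
  have hN := zpowers_normal_of_rel hrel hgen
  have hmem : A⁻¹ * S.prod * A ∈ zpowers x := hN.conj_mem' _ hSx A
  have hne : A⁻¹ * S.prod * A ≠ 1 := by
    intro h
    exact hS1 (by simpa using (conj_eq_one_iff (a := A⁻¹) (b := S.prod)).mp (by simpa using h))
  have hcomm : Commute T.prod (A⁻¹ * S.prod * A) := by
    rw [hsplit] at heq
    change T.prod * (A⁻¹ * S.prod * A) = A⁻¹ * S.prod * A * T.prod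
    nth_rewrite 1 [heq]
    group
  obtain ⟨k, hk⟩ := mem_zpowers_iff.mp (mem_zpowers_of_orderOf_prime (hordx ▸ hq) hmem hne)
  have hTx : T.prod ∈ zpowers x :=
    mem_zpowers_of_commute hg hordx hordy hrel hgen (hk ▸ hcomm.zpow_right k)
  have hempty := hmin T (ne_nil_of_length_pos (by lia))
    ((drop_sublist _ _).trans (take_sublist _ _)) (by lia)
  exact hempty.le ⟨prod_mem_PiSet_self T, hTx⟩

end Metacyclic

/-- Bass's lemma: if `S` is a nonempty sequence over `G = Z_n ⋉ Z_q` (with `q` prime,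
`ord_q(g) = n`, `H = ⟨x⟩`) minimal with respect to `Π(S) ∩ H ≠ ∅`, then `Π(S) ⊆ H` and
either `1 ∈ Π(S)` or `|Π(S)| ≥ |S|`. -/
theorem bass_minimal_lemma (q n g : ℕ) (hq : q.Prime) (hg : orderOf (g : ZMod q) = n)
    (G : Type*) [Group G] [Finite G] (x y : G)
    (hordx : orderOf x = q) (hordy : orderOf y = n)
    (hrel : x ^ g * y = y * x)
    (hgen : Subgroup.closure ({x, y} : Set G) = ⊤)
    (S : List G) (hS : S ≠ [])
    (hmeet : (PiSet S ∩ (Subgroup.zpowers x : Set G)).Nonempty)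
    (hmin : ∀ T : List G, T ≠ [] → T.Sublist S → T.length < S.length →
      PiSet T ∩ (Subgroup.zpowers x : Set G) = ∅) :
    PiSet S ⊆ (Subgroup.zpowers x : Set G) ∧
      (IsProdOne S ∨ S.length ≤ (PiSet S).ncard) := by
  have hsub := PiSet_subset_zpowers_of_inter_nonempty (zpowers_normal_of_rel hrel hgen) hgen hmeet
  refine ⟨hsub, or_iff_not_imp_left.mpr fun hone => ?_⟩
  have hSx := hsub (prod_mem_PiSet_self S)
  have hS1 : S.prod ≠ 1 := fun h => hone ⟨S, Perm.refl S, h⟩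
  have hne {i j : ℕ} (hij : i < j) (hj : j < S.length) :=
    prod_rotate_ne_of_lt hq hg hordx hordy hrel hgen hmin hSx hS1 hij hj
  have hinj : Set.InjOn (fun i => (S.rotate i).prod) (Set.Iio S.length) := by
    intro i hi j hj heq
    rcases lt_trichotomy i j with h | h | h
    · exact (hne h hj heq).elim
    · exact h
    · exact (hne h hi heq.symm).elim
  have himage : (fun i => (S.rotate i).prod) '' Set.Iio S.length ⊆ PiSet S := by
    rintro _ ⟨i, -, rfl⟩
    exact ⟨_, rotate_perm S i, rfl⟩
  calc S.length = ((fun i => (S.rotate i).prod) '' Set.Iio S.length).ncard := by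
        rw [hinj.ncard_image, Set.ncard_eq_toFinset_card']; simp
    _ ≤ (PiSet S).ncard := Set.ncard_le_ncard himage (Set.toFinite _)
end

section
/- Let p and q be distinct odd primes with p dividing q - 1, and let G = Z_p semidirect Z_q = <x, y | x^q = y^p = 1, x^g y = y x> with ord_q(g) = p. Then f(G) = q; that is, every sequence over G of length d(G) = p + q - 1 contains a nonempty product-one subsequence of length at most q, and q is optimal. -/
open List Subgroup

/-- Coordinates `(translation, height)` on a group, realising it as affine maps
`t ↦ χ(height) * t + translation` of `ZMod q`. -/
structure AffineCoords (p q : ℕ) (G : Type*) [Group G] where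
  tr : G → ZMod q
  ht : G → ZMod p
  χ : ZMod p → ZMod q
  χ_zero : χ 0 = 1
  χ_add : ∀ a b, χ (a + b) = χ a * χ b
  χ_injective : Function.Injective χ
  ht_mul : ∀ s t, ht (s * t) = ht s + ht t
  tr_mul : ∀ s t, tr (s * t) = tr s + χ (ht s) * tr t
  ext : ∀ s t, ht s = ht t → tr s = tr t → s = t

namespace AffineCoords

variable {p q : ℕ} {G : Type*} [Group G] (C : AffineCoords p q G)

theorem ht_one : C.ht 1 = 0 := by
  have h := C.ht_mul 1 1
  simpa using h

theorem tr_one : C.tr 1 = 0 := by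
  have h := C.tr_mul 1 1
  simpa [C.ht_one, C.χ_zero] using h

theorem χ_mul_neg (a : ZMod p) : C.χ a * C.χ (-a) = 1 := by
  rw [← C.χ_add, add_neg_cancel, C.χ_zero]

theorem χ_ne_zero [Fact q.Prime] (a : ZMod p) : C.χ a ≠ 0 := fun h => by
  have := C.χ_mul_neg a
  simp [h] at this

theorem χ_nsmul (a : ZMod p) (n : ℕ) : C.χ (n • a) = C.χ a ^ n := by
  induction n with
  | zero => simp [C.χ_zero]
  | succ n ih => rw [succ_nsmul, C.χ_add, ih, pow_succ]

theorem χ_pow_card (a : ZMod p) : C.χ a ^ p = 1 := by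
  rw [← C.χ_nsmul]
  simp [C.χ_zero]

theorem ht_prod (l : List G) : C.ht l.prod = (l.map C.ht).sum := by
  induction l with
  | nil => simp [C.ht_one]
  | cons s l ih => simp [C.ht_mul, ih]

theorem eq_one_of_coords {s : G} (h : C.ht s = 0) (h' : C.tr s = 0) : s = 1 :=
  C.ext _ _ (h.trans C.ht_one.symm) (h'.trans C.tr_one.symm)

theorem tr_mul_of_ht_eq_zero {s : G} (h : C.ht s = 0) (t : G) :
    C.tr (s * t) = C.tr s + C.tr t := by
  rw [C.tr_mul, h, C.χ_zero, one_mul]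

/-- Cyclic rotation of a product of height `0` rescales its translation part. -/
theorem tr_mul_swap {s t : G} (h : C.ht (s * t) = 0) :
    C.tr (t * s) = C.χ (-C.ht s) * C.tr (s * t) := by
  have hts : C.ht t = -C.ht s := by
    rw [C.ht_mul] at h
    exact (neg_eq_of_add_eq_zero_right h).symm
  rw [C.tr_mul, C.tr_mul, hts, mul_add, ← mul_assoc, mul_comm (C.χ (-C.ht s)) (C.χ (C.ht s)),
    C.χ_mul_neg]
  ring

end AffineCoords

/-- A sequence none of whose nonempty subsequences has an ordering with product one. -/
def ProdOneFree {G : Type*} [Group G] (S : Multiset G) : Prop :=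
  ∀ l : List G, l ≠ [] → (l : Multiset G) ≤ S → l.prod ≠ 1

theorem ProdOneFree.mono {G : Type*} [Group G] {S T : Multiset G} (hT : ProdOneFree T)
    (h : S ≤ T) : ProdOneFree S := fun l hl hS => hT l hl (hS.trans h)

/-- Enough elements of a sequence, grouped by the value of `f`, either contain many elements with
the same value or many disjoint pairs with distinct values. -/
theorem exists_constant_or_pairs {ι : Type*} (f : ι → ℕ) (S : Multiset ι) (h r : ℕ)
    (hrh : r ≤ h) (hS : h + r ≤ S.card) :
    (∃ b, ∃ T ≤ S, T.card = h + 1 ∧ ∀ a ∈ T, f a = b) ∨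
      ∃ L : List (ι × ι), L.length = r ∧ (∀ x ∈ L, f x.1 ≠ f x.2) ∧
        (L.map Prod.fst : Multiset ι) + (L.map Prod.snd : Multiset ι) ≤ S := by
  classical
  let R : ι → ι → Prop := fun a b => f a ≤ f b
  have : Std.Total R := ⟨fun a b => le_total (f a) (f b)⟩
  have : IsTrans ι R := ⟨fun a b c hab hbc => le_trans hab hbc⟩
  obtain ⟨l₀, rfl⟩ : ∃ l : List ι, (l : Multiset ι) = S := Quot.exists_rep S
  set l := l₀.insertionSort R with hl
  have hperm : l.Perm l₀ := List.perm_insertionSort R l₀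
  have hsort : l.Pairwise R := List.pairwise_insertionSort R l₀
  have hlen : h + r ≤ l.length := by simpa [hperm.length_eq] using hS
  have hmono : ∀ i j (hj : j < l.length) (hij : i ≤ j), f (l[i]'(by omega)) ≤ f l[j] := by
    intro i j hj hij
    rcases hij.eq_or_lt with rfl | hlt
    · exact le_rfl
    · exact List.pairwise_iff_getElem.1 hsort i j (by omega) hj hlt
  have hle : (l : Multiset ι) ≤ (l₀ : Multiset ι) := (Multiset.coe_eq_coe.2 hperm).le
  by_cases hc : ∃ i, ∃ hi : i < r, f (l[i]'(by omega)) = f (l[i + h]'(by omega))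
  · obtain ⟨i, hi, he⟩ := hc
    refine Or.inl ⟨f (l[i]'(by omega)), ((l.drop i).take (h + 1) : List ι), ?_, ?_, ?_⟩
    · refine le_trans (Multiset.coe_le.2 (List.Sublist.subperm ?_)) hle
      exact (List.take_sublist _ _).trans (List.drop_sublist _ _)
    · simp only [Multiset.coe_card, List.length_take, List.length_drop]
      omega
    · intro a ha
      obtain ⟨j, hj, rfl⟩ := List.getElem_of_mem (Multiset.mem_coe.1 ha)
      simp only [List.length_take, List.length_drop] at hj
      simp only [List.getElem_take, List.getElem_drop]
      refine le_antisymm ?_ (hmono _ _ _ (by omega))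
      rw [he]
      exact hmono _ _ _ (by omega)
  · push Not at hc
    refine Or.inr ⟨(l.take r).zip ((l.drop h).take r), ?_, ?_, ?_⟩
    · simp only [List.length_zip, List.length_take, List.length_drop]
      omega
    · intro x hx
      obtain ⟨j, hj, rfl⟩ := List.getElem_of_mem hx
      simp only [List.length_zip, List.length_take, List.length_drop] at hj
      simp only [List.getElem_zip, List.getElem_take, List.getElem_drop, add_comm h j]
      exact hc j (by omega)
    · rw [← List.unzip_fst, ← List.unzip_snd, List.unzip_zip (by simp; omega)]
      refine le_trans ?_ hle
      rw [Multiset.coe_add, Multiset.coe_le]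
      refine List.Sublist.subperm ?_
      conv_rhs => rw [← List.take_append_drop h l]
      refine List.Sublist.append ?_ (List.take_sublist _ _)
      exact List.take_sublist_take_left hrh

theorem exists_le_card_eq {ι : Type*} {S : Multiset ι} {n : ℕ} (hn : n ≤ S.card) :
    ∃ T ≤ S, T.card = n := by
  obtain ⟨l, rfl⟩ : ∃ l : List ι, (l : Multiset ι) = S := Quot.exists_rep S
  exact ⟨(l.take n : List ι), Multiset.coe_le.2 (List.take_sublist n l).subperm, by simpa using hn⟩

namespace AffineCoords

open scoped Pointwise

variable {p q : ℕ} {G : Type*} [Group G] (C : AffineCoords p q G)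

theorem card_le_card_image_rotate [Fact q.Prime] (l : List G) (hl : C.ht l.prod = 0)
    (hfree : C.tr l.prod ≠ 0)
    (hmin : ∀ T < (l : Multiset G), T ≠ 0 → (T.map C.ht).sum ≠ 0) :
    ((Finset.range l.length).image fun i => C.tr (l.rotate i).prod).card = l.length := by
  have hrot : ∀ i < l.length,
      C.tr (l.rotate i).prod = C.χ (-C.ht (l.take i).prod) * C.tr l.prod := by
    intro i hi
    rw [List.rotate_eq_drop_append_take hi.le, List.prod_append]
    have h := l.prod_take_mul_prod_drop i
    rw [C.tr_mul_swap (by rwa [h]), h]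
  have hne : ∀ i j, i < j → j < l.length →
      C.tr (l.rotate i).prod ≠ C.tr (l.rotate j).prod := by
    intro i j hij hj he
    rw [hrot i (hij.trans hj), hrot j hj] at he
    have h := neg_injective (C.χ_injective (mul_right_cancel₀ hfree he))
    have hsplit : l.take j = l.take i ++ (l.take j).drop i := by
      conv_lhs => rw [← List.take_append_drop i (l.take j)]
      rw [List.take_take, min_eq_left hij.le]
    rw [hsplit, List.prod_append, C.ht_mul, left_eq_add, C.ht_prod] at h
    have hlen : ((l.take j).drop i).length = j - i := by
      simp only [List.length_drop, List.length_take]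
      omega
    refine hmin ((l.take j).drop i : List G) ?_ ?_ (by simpa using h)
    · refine lt_of_le_of_ne (Multiset.coe_le.2 (List.Sublist.subperm
        ((List.drop_sublist _ _).trans (List.take_sublist _ _)))) fun he' => ?_
      have := congrArg Multiset.card he'
      simp only [Multiset.coe_card, hlen] at this
      omega
    · intro he'
      have := congrArg Multiset.card he'
      simp only [Multiset.coe_card, hlen, Multiset.card_zero] at this
      omega
  rw [Finset.card_image_of_injOn, Finset.card_range]
  intro i hi j hj he
  simp only [Finset.coe_range, Set.mem_Iio] at hi hj
  rcases lt_trichotomy i j with h | h | h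
  · exact absurd he (hne i j h hj)
  · exact h
  · exact absurd he.symm (hne j i h hi)

/-- A sequence of total height `0` without product-one subsequences contains a block `M` of total
height `0` whose orderings have at least `|M|` distinct products. -/
theorem exists_block [Fact q.Prime] (R : Multiset G) (hR : R ≠ 0)
    (hfree : ProdOneFree R) (hsum : (R.map C.ht).sum = 0) :
    ∃ M ≤ R, M ≠ 0 ∧ (M.map C.ht).sum = 0 ∧ ∃ X : Finset (ZMod q), M.card ≤ X.card ∧
      ∀ a ∈ X, ∃ l : List G, (l : Multiset G) = M ∧ C.tr l.prod = a := by
  induction R using Multiset.strongInductionOn with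
  | ih R ih =>
    by_cases h : ∃ T < R, T ≠ 0 ∧ (T.map C.ht).sum = 0
    · obtain ⟨T, hT, hT0, hTs⟩ := h
      obtain ⟨M, hM, h'⟩ := ih T hT hT0 (hfree.mono hT.le) hTs
      exact ⟨M, hM.trans hT.le, h'⟩
    · push Not at h
      obtain ⟨l, rfl⟩ : ∃ l : List G, (l : Multiset G) = R := Quot.exists_rep R
      have hl : C.ht l.prod = 0 := by simpa [C.ht_prod] using hsum
      refine ⟨l, le_rfl, hR, hsum, _, (C.card_le_card_image_rotate l hl ?_ h).ge, ?_⟩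
      · exact fun h0 => hfree l (by simpa using hR) le_rfl (C.eq_one_of_coords hl h0)
      · intro a ha
        obtain ⟨i, -, rfl⟩ := Finset.mem_image.1 ha
        exact ⟨l.rotate i, Multiset.coe_eq_coe.2 (List.rotate_perm l i), rfl⟩

theorem cauchy_davenport_of_card_le [hq : Fact q.Prime] {X Y Z : Finset (ZMod q)} {m n : ℕ}
    (hm : 0 < m) (hX : m ≤ X.card) (hY : min q (n + 1) ≤ Y.card)
    (h : ∀ a ∈ X, ∀ b ∈ Y, a + b ∈ Z) : min q (m + n) ≤ Z.card := by
  have hqp := hq.out.pos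
  have hXn : X.Nonempty := Finset.card_pos.1 (by omega)
  have hYn : Y.Nonempty := Finset.card_pos.1 (by omega)
  have hcd := ZMod.cauchy_davenport hq.out hXn hYn
  have hsub : (X + Y).card ≤ Z.card := Finset.card_le_card fun z hz => by
    obtain ⟨a, ha, b, hb, rfl⟩ := Finset.mem_add.1 hz
    exact h a ha b hb
  omega

/-- A sequence `R` of total height `0` without product-one subsequences has at least
`min q (|R| + 1)` subsequence products of height `0`. -/
theorem exists_subproducts [hq : Fact q.Prime] (R : Multiset G) (hfree : ProdOneFree R)
    (hsum : (R.map C.ht).sum = 0) :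
    ∃ Y : Finset (ZMod q), min q (R.card + 1) ≤ Y.card ∧
      ∀ a ∈ Y, ∃ l : List G, (l : Multiset G) ≤ R ∧ C.ht l.prod = 0 ∧ C.tr l.prod = a := by
  classical
  induction R using Multiset.strongInductionOn with
  | ih R ih =>
    rcases eq_or_ne R 0 with rfl | hR
    · refine ⟨{0}, by simp, fun a ha => ⟨[], by simp, ?_, ?_⟩⟩
      · simp [C.ht_one]
      · simpa [C.tr_one, eq_comm] using ha
    · obtain ⟨M, hM, hM0, hMs, X, hX, hXM⟩ := C.exists_block R hR hfree hsum
      obtain ⟨R', rfl⟩ := Multiset.le_iff_exists_add.1 hM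
      have hMc : 0 < M.card := Multiset.card_pos.2 hM0
      have hR's : (R'.map C.ht).sum = 0 := by simpa [hMs] using hsum
      have hlt : R' < M + R' := lt_of_le_of_ne (Multiset.le_add_left _ _) fun he => by
        have := congrArg Multiset.card he
        simp only [Multiset.card_add] at this
        omega
      obtain ⟨Y, hY, hYR⟩ := ih R' hlt (hfree.mono hlt.le) hR's
      have hXM' : ∀ a ∈ X, ∃ l : List G, (l : Multiset G) = M ∧ C.ht l.prod = 0 ∧
          C.tr l.prod = a := by
        intro a ha
        obtain ⟨l, rfl, hl⟩ := hXM a ha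
        exact ⟨l, rfl, by simpa [C.ht_prod] using hMs, hl⟩
      have h0X : (0 : ZMod q) ∉ X := by
        intro h0
        obtain ⟨l, rfl, hl0, hl⟩ := hXM' 0 h0
        exact hfree l (by simpa using hM0) hM (C.eq_one_of_coords hl0 hl)
      refine ⟨insert 0 X + Y, ?_, ?_⟩
      · have := cauchy_davenport_of_card_le (X := insert 0 X) (Y := Y) (Z := insert 0 X + Y)
          (m := M.card + 1) (n := R'.card) (by omega)
          (by rw [Finset.card_insert_of_notMem h0X]; omega) hY
          fun a ha b hb => Finset.add_mem_add ha hb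
        simpa [add_right_comm] using this
      · intro a ha
        obtain ⟨u, hu, v, hv, rfl⟩ := Finset.mem_add.1 ha
        obtain ⟨l', hl', hl'0, rfl⟩ := hYR v hv
        rcases Finset.mem_insert.1 hu with rfl | hu
        · exact ⟨l', hl'.trans (Multiset.le_add_left _ _), hl'0, by simp⟩
        · obtain ⟨l, rfl, hl0, rfl⟩ := hXM' u hu
          refine ⟨l ++ l', ?_, ?_, ?_⟩
          · rw [← Multiset.coe_add]
            gcongr
          · rw [List.prod_append, C.ht_mul, hl0, hl'0, add_zero]
          · rw [List.prod_append, C.tr_mul_of_ht_eq_zero hl0]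

theorem not_prodOneFree_of_card_lt [Fact q.Prime] {V R : Multiset G} {X Y : Finset (ZMod q)}
    (hXY : q < X.card + Y.card)
    (hX : ∀ a ∈ X, ∃ l : List G, l ≠ [] ∧ (l : Multiset G) ≤ V ∧ C.ht l.prod = 0 ∧
      C.tr l.prod = a)
    (hY : ∀ a ∈ Y, ∃ l : List G, (l : Multiset G) ≤ R ∧ C.ht l.prod = 0 ∧ C.tr l.prod = a) :
    ¬ ProdOneFree (V + R) := by
  classical
  obtain ⟨a, ha⟩ := Finset.inter_nonempty_of_card_lt_card_add_card (Finset.subset_univ X)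
    (Finset.subset_univ (-Y)) (by simpa [ZMod.card] using hXY)
  obtain ⟨haX, haY⟩ := Finset.mem_inter.1 ha
  obtain ⟨l, hl, hlV, hl0, hla⟩ := hX a haX
  obtain ⟨l', hlR, hl'0, hla'⟩ := hY (-a) (Finset.mem_neg'.1 haY)
  refine fun hfree => hfree (l ++ l') (by simp [hl]) ?_ (C.eq_one_of_coords ?_ ?_)
  · rw [← Multiset.coe_add]
    gcongr
  · rw [List.prod_append, C.ht_mul, hl0, hl'0, add_zero]
  · rw [List.prod_append, C.tr_mul_of_ht_eq_zero hl0, hla, hla', add_neg_cancel]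

/-- A sequence of length `q` and total height `0` has a product-one subsequence. -/
theorem not_prodOneFree_of_sum_eq_zero [hq : Fact q.Prime] (S : Multiset G) (hS : S.card = q)
    (hsum : (S.map C.ht).sum = 0) : ¬ ProdOneFree S := by
  intro hfree
  have hqp := hq.out.pos
  obtain ⟨M, hM, hM0, hMs, X, hX, hXM⟩ :=
    C.exists_block S (Multiset.card_pos.1 (by omega)) hfree hsum
  obtain ⟨R, rfl⟩ := Multiset.le_iff_exists_add.1 hM
  have hMc : 0 < M.card := Multiset.card_pos.2 hM0
  obtain ⟨Y, hY, hYR⟩ := C.exists_subproducts R (hfree.mono (Multiset.le_add_left _ _))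
    (by simpa [hMs] using hsum)
  rw [Multiset.card_add] at hS
  refine C.not_prodOneFree_of_card_lt (X := X) (by omega) (fun a ha => ?_) hYR hfree
  obtain ⟨l, rfl, hl⟩ := hXM a ha
  exact ⟨l, by simpa using hM0, le_rfl, by simpa [C.ht_prod] using hMs, hl⟩

/-- Choosing one term from each of `r` disjoint pairs of distinct heights realises at least
`min p (r + 1)` total heights. -/
theorem exists_transversal_sums [hp : Fact p.Prime] (L : List (G × G))
    (hL : ∀ x ∈ L, C.ht x.1 ≠ C.ht x.2) :
    ∃ X : Finset (ZMod p), min p (L.length + 1) ≤ X.card ∧ ∀ a ∈ X, ∃ T : Multiset G,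
      T ≤ (L.map Prod.fst : Multiset G) + (L.map Prod.snd : Multiset G) ∧
      T.card = L.length ∧ (T.map C.ht).sum = a := by
  classical
  induction L with
  | nil => exact ⟨{0}, by simp, fun a ha => ⟨0, by simp, by simp, by simpa [eq_comm] using ha⟩⟩
  | cons x L ih =>
    obtain ⟨Y, hY, hYL⟩ := ih fun z hz => hL z (List.mem_cons_of_mem _ hz)
    have hx := hL x List.mem_cons_self
    refine ⟨{C.ht x.1, C.ht x.2} + Y, ?_, ?_⟩
    · have := cauchy_davenport_of_card_le (X := {C.ht x.1, C.ht x.2}) (Y := Y)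
        (Z := {C.ht x.1, C.ht x.2} + Y) (m := 2) (n := L.length) (by omega)
        (Finset.card_pair hx).ge hY fun a ha b hb => Finset.add_mem_add ha hb
      simpa [add_comm, add_left_comm] using this
    · intro a ha
      obtain ⟨u, hu, v, hv, rfl⟩ := Finset.mem_add.1 ha
      obtain ⟨T, hT, hTc, rfl⟩ := hYL v hv
      have key : ((x :: L).map Prod.fst : Multiset G) + ((x :: L).map Prod.snd : Multiset G) =
          {x.1} + {x.2} + ((L.map Prod.fst : Multiset G) + (L.map Prod.snd : Multiset G)) := by
        rw [List.map_cons, List.map_cons, ← Multiset.cons_coe, ← Multiset.cons_coe,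
          ← Multiset.singleton_add, ← Multiset.singleton_add x.2]
        abel
      rw [key]
      have hu' : ∃ s, ({s} : Multiset G) ≤ {x.1} + {x.2} ∧ C.ht s = u := by
        rcases Finset.mem_insert.1 hu with rfl | hu
        · exact ⟨x.1, Multiset.le_add_right _ _, rfl⟩
        · exact ⟨x.2, Multiset.le_add_left _ _, (Finset.mem_singleton.1 hu).symm⟩
      obtain ⟨s, hs, rfl⟩ := hu'
      exact ⟨{s} + T, add_le_add hs hT, by simp [hTc, add_comm], by simp⟩

/-- Every sequence of length `p + q - 1` has either a subsequence of length `q` and total height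
`0`, or `q + 1` terms of the same height. -/
theorem exists_sum_eq_zero_or_constant [hp : Fact p.Prime] (S : Multiset G) (hpq : p ≤ q)
    (hS : S.card = p + q - 1) :
    (∃ T ≤ S, T.card = q ∧ (T.map C.ht).sum = 0) ∨
      ∃ b, ∃ T ≤ S, T.card = q + 1 ∧ ∀ s ∈ T, C.ht s = b := by
  have hpp := hp.out.pos
  rcases exists_constant_or_pairs (fun s => (C.ht s).val) S q (p - 1) (by omega) (by omega) with
    ⟨b, T, hT, hTc, hTb⟩ | ⟨L, hL, hne, hle⟩
  · refine Or.inr ⟨(b : ZMod p), T, hT, hTc, fun s hs => ?_⟩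
    rw [← hTb s hs, ZMod.natCast_zmod_val]
  · obtain ⟨X, hX, hXL⟩ := C.exists_transversal_sums L fun x hx h => hne x hx (by simp [h])
    have hXu : X = Finset.univ := by
      rw [← Finset.card_eq_iff_eq_univ, ZMod.card]
      refine le_antisymm ?_ (by omega)
      simpa [ZMod.card] using Finset.card_le_univ X
    obtain ⟨T, hT, hTc, hTs⟩ := hXL ((S.map C.ht).sum) (by simp [hXu])
    obtain ⟨T', rfl⟩ := Multiset.le_iff_exists_add.1 (hT.trans hle)
    refine Or.inl ⟨T', Multiset.le_add_left _ _, ?_, ?_⟩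
    · rw [Multiset.card_add] at hS
      omega
    · rwa [Multiset.map_add, Multiset.sum_add, left_eq_add] at hTs

end AffineCoords

/-- In a field, at most `(p - 1) / 2` roots of `X ^ p = κ` stay roots after translation by `e`. -/
theorem two_mul_card_add_one_le_of_pow_eq {F : Type*} [Field F] (h2 : (2 : F) ≠ 0) {p : ℕ}
    (hp : Odd p) {κ e : F} (hκ : κ ≠ 0) (he : e ≠ 0) (R : Finset F)
    (hR : ∀ x ∈ R, x ^ p = κ ∧ (x + e) ^ p = κ) : 2 * R.card + 1 ≤ p := by
  classical
  have hp0 : p ≠ 0 := hp.pos.ne'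
  have hx0 : ∀ x ∈ R, x ≠ 0 := by
    rintro x hx rfl
    exact hκ (by rw [← (hR 0 hx).1, zero_pow hp0])
  have hxe : ∀ x ∈ R, x + e ≠ 0 := by
    intro x hx h
    exact hκ (by rw [← (hR x hx).2, h, zero_pow hp0])
  have hinj : Set.InjOn (fun x => (x + e) / x) R := by
    intro x hx z hz h
    simp only at h
    rw [div_eq_div_iff (hx0 x hx) (hx0 z hz)] at h
    exact (mul_left_cancel₀ he (by linear_combination h)).symm
  have hinj' : Set.InjOn (fun x => x / (x + e)) R := by
    intro x hx z hz h
    simp only at h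
    rw [div_eq_div_iff (hxe x hx) (hxe z hz)] at h
    exact mul_left_cancel₀ he (by linear_combination h)
  have hdisj : Disjoint (R.image fun x => (x + e) / x) (R.image fun x => x / (x + e)) := by
    rw [Finset.disjoint_left]
    intro _ h h'
    obtain ⟨x, hx, rfl⟩ := Finset.mem_image.1 h
    obtain ⟨z, hz, h⟩ := Finset.mem_image.1 h'
    rw [div_eq_div_iff (hxe z hz) (hx0 x hx)] at h
    have hz' : z = -(x + e) := by
      have : e * z = e * -(x + e) := by linear_combination -h
      exact mul_left_cancel₀ he this
    have hzp := (hR z hz).1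
    rw [hz', hp.neg_pow, (hR x hx).2] at hzp
    have : 2 * κ = 0 := by linear_combination -hzp
    exact (mul_ne_zero h2 hκ) this
  have h1 : (1 : F) ∉ (R.image fun x => (x + e) / x) ∪ (R.image fun x => x / (x + e)) := by
    intro h
    rcases Finset.mem_union.1 h with h | h <;> obtain ⟨x, hx, h⟩ := Finset.mem_image.1 h
    · rw [div_eq_one_iff_eq (hx0 x hx)] at h
      exact he (by simpa using h)
    · rw [div_eq_one_iff_eq (hxe x hx)] at h
      exact he (by simpa using h)
  have hsub : insert 1 ((R.image fun x => (x + e) / x) ∪ (R.image fun x => x / (x + e))) ⊆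
      (Polynomial.nthRoots p (1 : F)).toFinset := by
    intro ζ hζ
    rw [Multiset.mem_toFinset, Polynomial.mem_nthRoots hp.pos]
    rcases Finset.mem_insert.1 hζ with rfl | hζ
    · simp
    rcases Finset.mem_union.1 hζ with h | h <;> obtain ⟨x, hx, rfl⟩ := Finset.mem_image.1 h <;>
      rw [div_pow, (hR x hx).1, (hR x hx).2, div_self hκ]
  have hcard := (Finset.card_le_card hsub).trans
    ((Multiset.toFinset_card_le _).trans (Polynomial.card_nthRoots p 1))
  rw [Finset.card_insert_of_notMem h1, Finset.card_union_of_disjoint hdisj,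
    Finset.card_image_of_injOn hinj, Finset.card_image_of_injOn hinj'] at hcard
  omega

namespace AffineCoords

open scoped Pointwise

variable {p q : ℕ} {G : Type*} [Group G] (C : AffineCoords p q G)

/-- Reordering `r` disjoint pairs of distinct terms of the same height `b ≠ 0` yields at least
`min q (r + 1)` products. -/
theorem exists_pair_products [hq : Fact q.Prime] {b : ZMod p} (hb : b ≠ 0) (L : List (G × G))
    (hne : ∀ x ∈ L, x.1 ≠ x.2) (hht : ∀ x ∈ L, C.ht x.1 = b ∧ C.ht x.2 = b) :
    ∃ Y : Finset (ZMod q), min q (L.length + 1) ≤ Y.card ∧ ∀ a ∈ Y, ∃ l : List G,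
      (l : Multiset G) = (L.map Prod.fst : Multiset G) + (L.map Prod.snd : Multiset G) ∧
      C.tr l.prod = a := by
  classical
  induction L with
  | nil => exact ⟨{0}, by simp, fun a ha => ⟨[], by simp, by simpa [C.tr_one, eq_comm] using ha⟩⟩
  | cons x L ih =>
    obtain ⟨Y, hY, hYL⟩ := ih (fun z hz => hne z (List.mem_cons_of_mem _ hz))
      fun z hz => hht z (List.mem_cons_of_mem _ hz)
    obtain ⟨s, t⟩ := x
    have hst : s ≠ t := hne _ List.mem_cons_self
    obtain ⟨hs, ht⟩ : C.ht s = b ∧ C.ht t = b := hht _ List.mem_cons_self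
    have hχ : C.χ b ≠ 1 := fun h => hb (C.χ_injective (h.trans C.χ_zero.symm))
    have hne' : C.tr (s * t) ≠ C.tr (t * s) := by
      intro h
      rw [C.tr_mul, C.tr_mul, hs, ht] at h
      refine hst (C.ext _ _ (hs.trans ht.symm) (sub_eq_zero.1 ?_))
      refine (mul_eq_zero.1 (?_ : (C.χ b - 1) * (C.tr s - C.tr t) = 0)).resolve_left
        (sub_ne_zero.2 hχ)
      linear_combination -h
    have hχ2 : C.χ (b + b) ≠ 0 := C.χ_ne_zero _
    let Y' := Y.image fun a => C.χ (b + b) * a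
    have hY' : Y'.card = Y.card := Finset.card_image_of_injective _ (mul_right_injective₀ hχ2)
    refine ⟨{C.tr (s * t), C.tr (t * s)} + Y', ?_, ?_⟩
    · have := cauchy_davenport_of_card_le (X := {C.tr (s * t), C.tr (t * s)}) (Y := Y')
        (Z := {C.tr (s * t), C.tr (t * s)} + Y') (m := 2) (n := L.length) (by omega)
        (Finset.card_pair hne').ge (hY.trans hY'.ge)
        fun a ha b hb => Finset.add_mem_add ha hb
      simpa [add_comm, add_left_comm] using this
    · intro a ha
      obtain ⟨u, hu, v, hv, rfl⟩ := Finset.mem_add.1 ha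
      obtain ⟨w, hw, rfl⟩ := Finset.mem_image.1 hv
      obtain ⟨l, hl, rfl⟩ := hYL w hw
      have key : (((s, t) :: L).map Prod.fst : Multiset G) +
          (((s, t) :: L).map Prod.snd : Multiset G) = {s} + {t} + (l : Multiset G) := by
        rw [List.map_cons, List.map_cons, ← Multiset.cons_coe, ← Multiset.cons_coe, hl,
          ← Multiset.singleton_add, ← Multiset.singleton_add t]
        abel
      rw [key]
      simp only [Finset.mem_insert, Finset.mem_singleton] at hu
      rcases hu with rfl | rfl
      · refine ⟨s :: t :: l, ?_, ?_⟩
        · rw [← Multiset.cons_coe, ← Multiset.cons_coe, ← Multiset.singleton_add,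
            ← Multiset.singleton_add t, add_assoc]
        · rw [List.prod_cons, List.prod_cons, ← mul_assoc, C.tr_mul, C.ht_mul, hs, ht]
      · refine ⟨t :: s :: l, ?_, ?_⟩
        · rw [← Multiset.cons_coe, ← Multiset.cons_coe, ← Multiset.singleton_add,
            ← Multiset.singleton_add s, ← add_assoc, add_comm ({t} : Multiset G)]
        · rw [List.prod_cons, List.prod_cons, ← mul_assoc, C.tr_mul, C.ht_mul, hs, ht]

theorem ht_prod_of_forall_eq {b : ZMod p} {l : List G} (hl : ∀ s ∈ l, C.ht s = b) :
    C.ht l.prod = l.length • b := by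
  rw [C.ht_prod, List.sum_eq_card_nsmul _ b (by simpa using hl), List.length_map]

theorem orderOf_χ [hp : Fact p.Prime] {b : ZMod p} (hb : b ≠ 0) : orderOf (C.χ b) = p :=
  orderOf_eq_prime (C.χ_pow_card b) fun h => hb (C.χ_injective (h.trans C.χ_zero.symm))

/-- A set of at most `p` nonzero elements closed under multiplication by `χ b`, `b ≠ 0`, is
contained in a coset of the group of `p`-th roots of unity. -/
theorem pow_eq_pow_of_closed [hp : Fact p.Prime] [Fact q.Prime] {b : ZMod p} (hb : b ≠ 0)
    {A : Finset (ZMod q)} (hA : A.card ≤ p) (hA0 : 0 ∉ A) (hcl : ∀ a ∈ A, C.χ b * a ∈ A)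
    {v z : ZMod q} (hv : v ∈ A) (hz : z ∈ A) : z ^ p = v ^ p := by
  classical
  have hv0 : v ≠ 0 := fun h => hA0 (h ▸ hv)
  have hmem : ∀ n : ℕ, C.χ b ^ n * v ∈ A := by
    intro n
    induction n with
    | zero => simpa using hv
    | succ n ih => simpa [pow_succ', mul_assoc] using hcl _ ih
  have hinj : Set.InjOn (fun n : ℕ => C.χ b ^ n * v) (Finset.range p : Finset ℕ) := by
    intro m hm n hn h
    rw [Finset.coe_range, Set.mem_Iio] at hm hn
    exact pow_injOn_Iio_orderOf (by rwa [Set.mem_Iio, C.orderOf_χ hb])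
      (by rwa [Set.mem_Iio, C.orderOf_χ hb]) (mul_right_cancel₀ hv0 h)
  have heq : (Finset.range p).image (fun n : ℕ => C.χ b ^ n * v) = A := by
    refine Finset.eq_of_subset_of_card_le ?_ ?_
    · intro _ h
      obtain ⟨n, -, rfl⟩ := Finset.mem_image.1 h
      exact hmem n
    · rwa [Finset.card_image_of_injOn hinj, Finset.card_range]
  rw [← heq] at hz
  obtain ⟨n, -, rfl⟩ := Finset.mem_image.1 hz
  rw [mul_pow, ← pow_mul, mul_comm n, pow_mul, C.χ_pow_card, one_pow, one_mul]

/-- Among `p + 1` terms of the same height `b ≠ 0`, paired off into distinct elements, the products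
of `p` terms take more than `p` values. -/
theorem exists_many_products [hp : Fact p.Prime] [hq : Fact q.Prime] (hpo : Odd p) (hpq : p < q)
    {b : ZMod p} (hb : b ≠ 0) (L : List (G × G)) (hL : 2 * L.length = p + 1)
    (hne : ∀ x ∈ L, x.1 ≠ x.2) (hht : ∀ x ∈ L, C.ht x.1 = b ∧ C.ht x.2 = b)
    (hfree : ProdOneFree ((L.map Prod.fst : Multiset G) + (L.map Prod.snd : Multiset G))) :
    ∃ X : Finset (ZMod q), p + 1 ≤ X.card ∧ ∀ a ∈ X, ∃ l : List G, l ≠ [] ∧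
      (l : Multiset G) ≤ (L.map Prod.fst : Multiset G) + (L.map Prod.snd : Multiset G) ∧
      C.ht l.prod = 0 ∧ C.tr l.prod = a := by
  classical
  have hpp := hp.out.two_le
  set V := (L.map Prod.fst : Multiset G) + (L.map Prod.snd : Multiset G) with hV
  have hVb : ∀ s ∈ V, C.ht s = b := by
    intro s hs
    rcases Multiset.mem_add.1 hs with h | h <;>
      obtain ⟨x, hx, rfl⟩ := List.mem_map.1 (Multiset.mem_coe.1 h)
    · exact (hht x hx).1
    · exact (hht x hx).2
  have hzero : ∀ l : List G, (l : Multiset G) ≤ V → l.length = p → C.ht l.prod = 0 := by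
    intro l hl hlen
    rw [C.ht_prod_of_forall_eq fun s hs => hVb s (Multiset.mem_of_le hl hs), hlen]
    simp
  let A : Finset (ZMod q) := Finset.univ.filter fun a =>
    ∃ l : List G, (l : Multiset G) ≤ V ∧ l.length = p ∧ C.tr l.prod = a
  have hA : ∀ a, a ∈ A ↔ ∃ l : List G, (l : Multiset G) ≤ V ∧ l.length = p ∧ C.tr l.prod = a :=
    fun a => by simp [A]
  refine ⟨A, ?_, fun a ha => ?_⟩
  swap
  · obtain ⟨l, hl, hlen, hla⟩ := (hA a).1 ha
    exact ⟨l, by rintro rfl; simp at hlen; omega, hl, hzero l hl hlen, hla⟩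
  by_contra hcard
  have hA0 : (0 : ZMod q) ∉ A := by
    intro h
    obtain ⟨l, hl, hlen, hla⟩ := (hA 0).1 h
    exact hfree l (by rintro rfl; simp at hlen; omega) hl
      (C.eq_one_of_coords (hzero l hl hlen) hla)
  have hcl : ∀ a ∈ A, C.χ (-b) * a ∈ A := by
    intro a ha
    obtain ⟨l, hl, hlen, rfl⟩ := (hA a).1 ha
    obtain ⟨s, l, rfl⟩ := List.exists_cons_of_ne_nil (l := l) (by rintro rfl; simp at hlen; omega)
    refine (hA _).2 ⟨l ++ [s], ?_, by simpa using hlen, ?_⟩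
    · rwa [Multiset.coe_eq_coe.2 (List.perm_append_singleton s l)]
    · have h0 := hzero _ hl hlen
      rw [List.prod_cons] at h0
      rw [List.prod_append, List.prod_singleton, List.prod_cons, C.tr_mul_swap h0,
        hVb s (Multiset.mem_of_le hl (by simp))]
  obtain ⟨⟨s, t⟩, L', rfl⟩ := List.exists_cons_of_ne_nil (l := L) (by rintro rfl; simp at hL)
  obtain ⟨Y, hY, hYL⟩ := C.exists_pair_products hb L'
    (fun z hz => hne z (List.mem_cons_of_mem _ hz)) fun z hz => hht z (List.mem_cons_of_mem _ hz)
  have hst : s ≠ t := hne _ List.mem_cons_self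
  obtain ⟨hs, ht⟩ : C.ht s = b ∧ C.ht t = b := hht _ List.mem_cons_self
  rw [List.length_cons] at hL
  have hlY : ∀ v ∈ Y, ∀ r, r = s ∨ r = t → C.tr r + C.χ b * v ∈ A := by
    intro v hv r hr
    obtain ⟨l, hl, rfl⟩ := hYL v hv
    have key : V = {s} + {t} + (l : Multiset G) := by
      rw [hV, List.map_cons, List.map_cons, ← Multiset.cons_coe, ← Multiset.cons_coe, hl,
        ← Multiset.singleton_add, ← Multiset.singleton_add t]
      abel
    have hlen := congrArg Multiset.card hl
    simp only [Multiset.coe_card, Multiset.card_add, List.length_map] at hlen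
    refine (hA _).2 ⟨r :: l, ?_, ?_, ?_⟩
    · rw [key, ← Multiset.cons_coe, ← Multiset.singleton_add]
      gcongr
      rcases hr with rfl | rfl
      · exact Multiset.le_add_right _ _
      · exact Multiset.le_add_left _ _
    · rw [List.length_cons]
      omega
    · rw [List.prod_cons, C.tr_mul]
      rcases hr with rfl | rfl
      · rw [hs]
      · rw [ht]
  have hYc : 0 < Y.card := by omega
  obtain ⟨y₀, hy₀⟩ := Finset.card_pos.1 hYc
  have hv := hlY y₀ hy₀ s (Or.inl rfl)
  have hpow := fun z hz => C.pow_eq_pow_of_closed (neg_ne_zero.2 hb) (by omega) hA0 hcl hv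
    (z := z) hz
  have h2 : (2 : ZMod q) ≠ 0 := by
    intro h
    have : q ∣ 2 := (ZMod.natCast_eq_zero_iff 2 q).1 (by exact_mod_cast h)
    have := Nat.le_of_dvd (by omega) this
    omega
  have hroots := two_mul_card_add_one_le_of_pow_eq h2 hpo
    (κ := (C.tr s + C.χ b * y₀) ^ p) (e := C.tr t - C.tr s)
    (pow_ne_zero _ fun h => hA0 (h ▸ hv))
    (sub_ne_zero.2 fun h => hst (C.ext _ _ (hs.trans ht.symm) h.symm))
    (Y.image fun v => C.tr s + C.χ b * v) (by
      intro x hx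
      obtain ⟨v, hv, rfl⟩ := Finset.mem_image.1 hx
      refine ⟨hpow _ (hlY v hv s (Or.inl rfl)), hpow _ ?_⟩
      convert hlY v hv t (Or.inr rfl) using 1
      ring)
  have hinj : Function.Injective fun v => C.tr s + C.χ b * v :=
    (add_right_injective _).comp (mul_right_injective₀ (C.χ_ne_zero b))
  rw [Finset.card_image_of_injective _ hinj] at hroots
  omega

theorem pow_eq_one_of_ht_ne_zero [hp : Fact p.Prime] [Fact q.Prime] {s : G} (hs : C.ht s ≠ 0) :
    s ^ p = 1 := by
  have h0 : C.ht (s ^ p) = 0 := by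
    rw [← List.prod_replicate, C.ht_prod]
    simp
  have hpow : s ^ p = s * s ^ (p - 1) := by
    rw [← pow_succ', Nat.sub_add_cancel hp.out.one_le]
  have h := C.tr_mul_swap (hpow ▸ h0)
  rw [← pow_succ, Nat.sub_add_cancel hp.out.one_le, ← hpow] at h
  have hχ : C.χ (-C.ht s) ≠ 1 := fun h1 =>
    neg_ne_zero.2 hs (C.χ_injective (h1.trans C.χ_zero.symm))
  refine C.eq_one_of_coords h0 ((mul_eq_zero.1
    (?_ : (C.χ (-C.ht s) - 1) * C.tr (s ^ p) = 0)).resolve_left (sub_ne_zero.2 hχ))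
  linear_combination -h

/-- Every sequence of length `p + q - 1` has a product-one subsequence of length at most `q`. -/
theorem exists_short_prod_one (C : AffineCoords p q G) [hp : Fact p.Prime] [hq : Fact q.Prime] [Finite G] (hpo : Odd p)
    (hqo : Odd q) (hpq : p < q) (hdvd : p ∣ q - 1) (S : Multiset G) (hS : S.card = p + q - 1) :
    ∃ l : List G, l ≠ [] ∧ (l : Multiset G) ≤ S ∧ l.length ≤ q ∧ l.prod = 1 := by
  classical
  have of_not_free : ∀ T ≤ S, T.card ≤ q → ¬ ProdOneFree T →
      ∃ l : List G, l ≠ [] ∧ (l : Multiset G) ≤ S ∧ l.length ≤ q ∧ l.prod = 1 := by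
    intro T hT hTc hfree
    unfold ProdOneFree at hfree
    push Not at hfree
    obtain ⟨l, hl, hlT, h1⟩ := hfree
    exact ⟨l, hl, hlT.trans hT, by simpa using (Multiset.card_le_card hlT).trans hTc, h1⟩
  rcases C.exists_sum_eq_zero_or_constant S hpq.le hS with
    ⟨T, hT, hTc, hTs⟩ | ⟨b, T, hT, hTc, hTb⟩
  · exact of_not_free T hT hTc.le (C.not_prodOneFree_of_sum_eq_zero T hTc hTs)
  have hpp := hp.out.two_le
  obtain ⟨m, hm⟩ := hdvd
  obtain ⟨k, hk⟩ := hpo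
  have hm2 : 2 ≤ m := by
    by_contra hlt
    obtain ⟨j, hj⟩ := hqo
    have : m = 0 ∨ m = 1 := by omega
    rcases this with rfl | rfl <;> omega
  obtain ⟨n, rfl⟩ := Nat.exists_eq_add_of_le hm2
  have hqn : q = p + p + p * n + 1 := by
    have : p * (2 + n) = p + p + p * n := by ring
    omega
  have sum_zero : ∀ R ≤ T, ∀ i, R.card = i → (i : ZMod p) * b = 0 → (R.map C.ht).sum = 0 := by
    intro R hR i hi h0
    rw [Multiset.map_congr rfl fun s hs => hTb s (Multiset.mem_of_le hR hs), Multiset.map_const',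
      Multiset.sum_replicate, hi, nsmul_eq_mul, h0]
  rcases eq_or_ne b 0 with rfl | hb
  · obtain ⟨R, hR, hRc⟩ := exists_le_card_eq (S := T) (n := q) (by omega)
    exact of_not_free R (hR.trans hT) hRc.le
      (C.not_prodOneFree_of_sum_eq_zero R hRc (sum_zero R hR q hRc (by simp)))
  obtain ⟨N, ⟨enum⟩⟩ := Finite.exists_equiv_fin G
  rcases exists_constant_or_pairs (fun s => (enum s : ℕ)) T (p - 1) (k + 1) (by omega) (by omega)
    with ⟨c, R, hR, hRc, hRe⟩ | ⟨L, hL, hne, hle⟩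
  · rw [Nat.sub_add_cancel (by omega)] at hRc
    obtain ⟨s, hs⟩ := Multiset.card_pos_iff_exists_mem.1 (show 0 < R.card by omega)
    have hRs : R = Multiset.replicate p s := Multiset.eq_replicate.2 ⟨hRc, fun t ht =>
      enum.injective (Fin.ext ((hRe t ht).trans (hRe s hs).symm))⟩
    refine ⟨List.replicate p s, by simp; omega, ?_, by simp; omega, ?_⟩
    · rw [Multiset.coe_replicate, ← hRs]
      exact hR.trans hT
    · rw [List.prod_replicate]
      have hs' := hTb s (Multiset.mem_of_le hR hs)
      exact C.pow_eq_one_of_ht_ne_zero (hs' ▸ hb)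
  · obtain ⟨R', hR'⟩ := Multiset.le_iff_exists_add.1 hle
    set V := (L.map Prod.fst : Multiset G) + (L.map Prod.snd : Multiset G) with hV
    have hVc : V.card = p + 1 := by
      simp [hV, hL]
      omega
    have hR'c := congrArg Multiset.card hR'
    rw [Multiset.card_add, hTc, hVc] at hR'c
    obtain ⟨R, hR, hRc⟩ := exists_le_card_eq (S := R') (n := p * (n + 1)) (by
      rw [mul_add]; omega)
    have hVR : V + R ≤ T := by
      rw [hR']
      gcongr
    refine of_not_free (V + R) (hVR.trans hT) ?_ fun hfree => ?_
    · rw [Multiset.card_add, hVc, hRc, mul_add]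
      omega
    obtain ⟨X, hX, hXV⟩ := C.exists_many_products ⟨k, hk⟩ hpq hb L (by omega)
      (fun x hx h => hne x hx (by rw [h]))
      (fun x hx => ⟨hTb _ (Multiset.mem_of_le hle (Multiset.mem_add.2 (Or.inl
          (Multiset.mem_coe.2 (List.mem_map_of_mem hx))))),
        hTb _ (Multiset.mem_of_le hle (Multiset.mem_add.2 (Or.inr
          (Multiset.mem_coe.2 (List.mem_map_of_mem hx)))))⟩)
      (hfree.mono (Multiset.le_add_right _ _))
    obtain ⟨Y, hY, hYR⟩ := C.exists_subproducts R (hfree.mono (Multiset.le_add_left _ _))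
      (sum_zero R ((Multiset.le_add_left _ _).trans hVR) _ hRc (by simp))
    refine C.not_prodOneFree_of_card_lt (X := X) (Y := Y) ?_ hXV hYR hfree
    rw [hRc, mul_add] at hY
    omega

end AffineCoords

theorem pow_mul_eq_mul_pow_of_rel {G : Type*} [Group G] {x y : G} {g : ℕ}
    (hrel : x ^ g * y = y * x) (i j : ℕ) : y ^ j * x ^ i = x ^ (i * g ^ j) * y ^ j := by
  have hone : ∀ i : ℕ, y * x ^ i = x ^ (i * g) * y := by
    intro i
    induction i with
    | zero => simp
    | succ i ih => rw [pow_succ, ← mul_assoc, ih, mul_assoc, ← hrel, ← mul_assoc, ← pow_add,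
        Nat.succ_mul]
  induction j generalizing i with
  | zero => simp
  | succ j ih => rw [pow_succ, mul_assoc, hone, ← mul_assoc, ih, mul_assoc, pow_succ' g, mul_assoc i]

theorem exists_eq_pow_mul_pow {G : Type*} [Group G] [Finite G] {x y : G} {g : ℕ}
    (hrel : x ^ g * y = y * x) (hgen : Subgroup.closure ({x, y} : Set G) = ⊤) (s : G) :
    ∃ i j : ℕ, s = x ^ i * y ^ j := by
  have hmul : ∀ i j i' j' : ℕ, ∃ k l : ℕ,
      (x ^ i * y ^ j) * (x ^ i' * y ^ j') = x ^ k * y ^ l := fun i j i' j' =>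
    ⟨i + i' * g ^ j, j + j', by
      rw [mul_assoc, ← mul_assoc (y ^ j), pow_mul_eq_mul_pow_of_rel hrel, pow_add, pow_add]
      simp only [mul_assoc]⟩
  have hs : s ∈ Subgroup.closure ({x, y} : Set G) := hgen ▸ Subgroup.mem_top s
  induction hs using Subgroup.closure_induction with
  | mem s hs =>
    rcases hs with rfl | rfl
    · exact ⟨1, 0, by simp⟩
    · exact ⟨0, 1, by simp⟩
  | one => exact ⟨0, 0, by simp⟩
  | mul s t _ _ hs ht =>
    obtain ⟨i, j, rfl⟩ := hs
    obtain ⟨i', j', rfl⟩ := ht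
    exact hmul i j i' j'
  | inv s _ hs =>
    have hpow : ∀ n : ℕ, ∃ i j : ℕ, s ^ n = x ^ i * y ^ j := by
      intro n
      induction n with
      | zero => exact ⟨0, 0, by simp⟩
      | succ n ih =>
        obtain ⟨i, j, h⟩ := ih
        obtain ⟨i', j', h'⟩ := hs
        rw [pow_succ, h, h']
        exact hmul i j i' j'
    obtain ⟨i, j, h⟩ := hpow (orderOf s - 1)
    refine ⟨i, j, ?_⟩
    rw [← h, inv_eq_iff_mul_eq_one, ← pow_succ', Nat.sub_add_cancel (orderOf_pos s),
      pow_orderOf_eq_one]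

theorem modEq_of_pow_mul_pow_eq {G : Type*} [Group G] {x y : G} {p q : ℕ} (hpq : Nat.Coprime p q)
    (hordx : orderOf x = q) (hordy : orderOf y = p) {i j i' j' : ℕ}
    (h : x ^ i * y ^ j = x ^ i' * y ^ j') : i ≡ i' [MOD q] ∧ j ≡ j' [MOD p] := by
  have h' : (x ^ i')⁻¹ * x ^ i = y ^ j' * (y ^ j)⁻¹ := by
    rw [eq_mul_inv_iff_mul_eq, mul_assoc, h, inv_mul_cancel_left]
  have hx : (x ^ i')⁻¹ * x ^ i ∈ Subgroup.zpowers x :=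
    mul_mem (inv_mem (Subgroup.npow_mem_zpowers x i')) (Subgroup.npow_mem_zpowers x i)
  have hy : (x ^ i')⁻¹ * x ^ i ∈ Subgroup.zpowers y :=
    h' ▸ mul_mem (Subgroup.npow_mem_zpowers y j') (inv_mem (Subgroup.npow_mem_zpowers y j))
  have h1 : (x ^ i')⁻¹ * x ^ i = 1 := by
    rw [← orderOf_eq_one_iff]
    refine Nat.eq_one_of_dvd_coprimes hpq ?_ ?_
    · exact hordy ▸ orderOf_dvd_of_mem_zpowers hy
    · exact hordx ▸ orderOf_dvd_of_mem_zpowers hx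
  constructor
  · rw [← hordx, ← pow_eq_pow_iff_modEq]
    exact (inv_mul_eq_one.1 h1).symm
  · rw [← hordy, ← pow_eq_pow_iff_modEq]
    rw [h1] at h'
    exact (mul_inv_eq_one.1 h'.symm).symm

theorem exists_affineCoords {p q g : ℕ} (hpq : Nat.Coprime p q) [hp : Fact p.Prime]
    (hg : orderOf (g : ZMod q) = p) {G : Type*} [Group G] [Finite G] {x y : G}
    (hordx : orderOf x = q) (hordy : orderOf y = p) (hrel : x ^ g * y = y * x)
    (hgen : Subgroup.closure ({x, y} : Set G) = ⊤) :
    ∃ C : AffineCoords p q G, C.ht x = 0 ∧ C.ht y = 1 := by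
  choose i j hij using exists_eq_pow_mul_pow hrel hgen
  have huniq : ∀ s (a b : ℕ), s = x ^ a * y ^ b → (i s : ZMod q) = a ∧ (j s : ZMod p) = b := by
    intro s a b h
    have := modEq_of_pow_mul_pow_eq hpq hordx hordy ((hij s).symm.trans h)
    exact ⟨(ZMod.natCast_eq_natCast_iff _ _ _).2 this.1,
      (ZMod.natCast_eq_natCast_iff _ _ _).2 this.2⟩
  have hmul : ∀ s t, s * t = x ^ (i s + i t * g ^ j s) * y ^ (j s + j t) := by
    intro s t
    conv_lhs => rw [hij s, hij t, mul_assoc, ← mul_assoc (y ^ j s),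
      pow_mul_eq_mul_pow_of_rel hrel]
    rw [pow_add, pow_add]
    simp only [mul_assoc]
  have hgmod : ∀ n : ℕ, (g : ZMod q) ^ (n % p) = (g : ZMod q) ^ n := by
    intro n
    conv_lhs => rw [← hg]
    exact pow_mod_orderOf _ n
  have hgpow : ∀ n : ℕ, (g : ZMod q) ^ (n : ZMod p).val = (g : ZMod q) ^ n := by
    intro n
    rw [ZMod.val_natCast, hgmod]
  refine ⟨{ tr := fun s => i s
            ht := fun s => j s
            χ := fun b => (g : ZMod q) ^ b.val
            χ_zero := by simp
            χ_add := fun a b => by rw [ZMod.val_add, ← pow_add, hgmod]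
            χ_injective := fun a b h => ZMod.val_injective p
              (pow_injOn_Iio_orderOf (by simpa [hg] using a.val_lt)
                (by simpa [hg] using b.val_lt) h)
            ht_mul := fun s t => by
              rw [(huniq _ _ _ (hmul s t)).2]
              push_cast
              rfl
            tr_mul := fun s t => by
              rw [(huniq _ _ _ (hmul s t)).1, hgpow]
              push_cast
              ring
            ext := fun s t h h' => by
              rw [hij s, hij t]
              congr 1
              · exact pow_eq_pow_iff_modEq.2
                  (hordx ▸ (ZMod.natCast_eq_natCast_iff _ _ _).1 h')
              · exact pow_eq_pow_iff_modEq.2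
                  (hordy ▸ (ZMod.natCast_eq_natCast_iff _ _ _).1 h) }, ?_, ?_⟩
  · simpa using (huniq x 1 0 (by simp)).2
  · simpa using (huniq y 0 1 (by simp)).2

/-- Product-one subsequences of `x^[n] y^[p - 1]` consist of at least `q` copies of `x`. -/
theorem le_of_isProdOne_sublist {p q : ℕ} {G : Type*} [Group G] (C : AffineCoords p q G)
    {x y : G} (hp : 0 < p) (hordx : orderOf x = q) (hx : C.ht x = 0) (hy : C.ht y = 1) {n : ℕ}
    {T : List G} (hT : T ≠ []) (hsub : T.Sublist (List.replicate n x ++ List.replicate (p - 1) y))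
    (h1 : IsProdOne T) : q ≤ T.length ∧ q ≤ n := by
  obtain ⟨_, _, rfl, hT₁, hT₂⟩ := List.sublist_append_iff.1 hsub
  obtain ⟨i, hi, rfl⟩ := List.sublist_replicate_iff.1 hT₁
  obtain ⟨j, hj, rfl⟩ := List.sublist_replicate_iff.1 hT₂
  obtain ⟨l, hl, hl1⟩ := h1
  have hj0 : j = 0 := by
    have h := congrArg C.ht hl1
    rw [C.ht_prod, (hl.map C.ht).sum_eq, C.ht_one] at h
    simp only [List.map_append, List.map_replicate, hx, hy, List.sum_append,
      List.sum_replicate, smul_zero, nsmul_eq_mul, mul_one, zero_add] at h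
    exact Nat.eq_zero_of_dvd_of_lt ((ZMod.natCast_eq_zero_iff j p).1 h) (by omega)
  subst hj0
  simp only [List.replicate_zero, List.append_nil] at hl hT ⊢
  rw [List.perm_replicate.1 hl, List.prod_replicate] at hl1
  have hdvd := orderOf_dvd_of_pow_eq_one hl1
  rw [hordx] at hdvd
  have := Nat.le_of_dvd (Nat.pos_of_ne_zero (by simpa using hT)) hdvd
  rw [List.length_replicate]
  omega

/-- For distinct odd primes `p, q` with `p ∣ q - 1` and `G = Z_p ⋉ Z_q`
(with `ord_q(g) = p`), we have `d(G) = p + q - 1` and `f(G) = q`. -/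
theorem f_const_pq (p q g : ℕ) (hp : p.Prime) (hq : q.Prime) (hpo : Odd p) (hqo : Odd q)
    (hne : p ≠ q) (hdvd : p ∣ q - 1) (hg : orderOf (g : ZMod q) = p)
    (G : Type*) [Group G] [Finite G] (x y : G)
    (hordx : orderOf x = q) (hordy : orderOf y = p)
    (hrel : x ^ g * y = y * x)
    (hgen : Subgroup.closure ({x, y} : Set G) = ⊤) :
    dC G = p + q - 1 ∧ fC G = q := by
  have : Fact p.Prime := ⟨hp⟩
  have : Fact q.Prime := ⟨hq⟩
  have hq2 := hq.two_le
  have hp2 := hp.two_le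
  have hpq : p < q := by
    have := Nat.le_of_dvd (by omega) hdvd
    omega
  obtain ⟨C, hx, hy⟩ := exists_affineCoords ((Nat.coprime_primes hp hq).2 hne) hg hordx hordy
    hrel hgen
  have hshort : ∀ S : List G, S.length = p + q - 1 →
      ∃ T : List G, T ≠ [] ∧ T.Sublist S ∧ T.length ≤ q ∧ IsProdOne T := by
    intro S hS
    obtain ⟨l, hl, hlS, hlq, hl1⟩ :=
      C.exists_short_prod_one hpo hqo hpq hdvd (S : Multiset G) (by simpa using hS)
    obtain ⟨T, hTl, hTS⟩ := Multiset.coe_le.1 hlS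
    exact ⟨T, fun h => hl (by simpa [h] using hTl.symm), hTS, hTl.length_eq ▸ hlq, l, hTl.symm, hl1⟩
  have hd : dC G = p + q - 1 := by
    refine le_antisymm (Nat.sInf_le ⟨by omega, fun S hS => ?_⟩)
      (le_csInf ⟨p + q - 1, by omega, fun S hS => ?_⟩ ?_)
    · obtain ⟨T, hT, hTS, -, h1⟩ := hshort S hS
      exact ⟨T, hT, hTS, h1⟩
    · obtain ⟨T, hT, hTS, -, h1⟩ := hshort S hS
      exact ⟨T, hT, hTS, h1⟩
    · rintro m ⟨-, hm⟩
      by_contra! hlt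
      obtain ⟨T, hT, hTS, h1⟩ := hm
        ((List.replicate (q - 1) x ++ List.replicate (p - 1) y).take m) (by simp; omega)
      have := (le_of_isProdOne_sublist C hp.pos hordx hx hy hT
        (hTS.trans (List.take_sublist _ _)) h1).2
      omega
  refine ⟨hd, le_antisymm (Nat.sInf_le ⟨by omega, fun S hS => hshort S (hS.trans hd)⟩)
    (le_csInf ⟨q, by omega, fun S hS => hshort S (hS.trans hd)⟩ ?_)⟩
  rintro m ⟨-, hm⟩
  obtain ⟨T, hT, hTS, hTm, h1⟩ := hm (List.replicate q x ++ List.replicate (p - 1) y)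
    (by simp [hd]; omega)
  exact (le_of_isProdOne_sublist C hp.pos hordx hx hy hT hTS h1).1.trans hTm
end

section
/- Let p be an odd prime and k > 1 a positive integer, and let G = Z_p semidirect Z_{p^k} = <x, y | x^{p^k} = y^p = 1, x^g y = y x> where g has multiplicative order p modulo p^k. Then d(G) = p^k + p - 1 and f(G) = p^k. -/
open List Subgroup

theorem nonempty_sublist_prod_eq_one {A α : Type*} [CommGroup A] {p : ℕ} [Fact p.Prime]
    (f : α → A) {a b c : A} {i j l : ℕ} (ha : a ^ p ^ i = 1) (hb : b ^ p ^ j = 1)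
    (hc : c ^ p ^ l = 1) (hf : ∀ s, f s ∈ Subgroup.closure ({a, b, c} : Set A))
    (S : List α) (hS : p ^ i + p ^ j + p ^ l ≤ S.length + 2) :
    ∃ T : List α, T ≠ [] ∧ T.Sublist S ∧ (T.map f).prod = 1 := by
  let R := MonoidAlgebra (ZMod p) A
  let o : A →* R := MonoidAlgebra.of (ZMod p) A
  have : CharP R p :=
    charP_of_injective_algebraMap (FaithfulSMul.algebraMap_injective (ZMod p) R) p
  have hpp : 0 < p := (Fact.out : p.Prime).pos
  let I : A → Ideal R := fun u => Ideal.span {o u - 1}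
  have hnil : ∀ u n, u ^ p ^ n = 1 → I u ^ p ^ n = 0 := by
    intro u n hu
    rw [Ideal.span_singleton_pow, sub_pow_char_pow, ← map_pow, hu]
    simp
  let J : Ideal R := I a + I b + I c
  have hJ : ∀ n, p ^ i + p ^ j + p ^ l ≤ n + 2 → J ^ n = 0 := by
    intro n hn
    have h1 : (I a + I b) ^ (p ^ i + p ^ j - 1) = 0 :=
      (Commute.all _ _).add_pow_eq_zero_of_add_le_succ_of_pow_eq_zero (hnil a i ha) (hnil b j hb)
        (by omega)
    exact (Commute.all _ _).add_pow_eq_zero_of_add_le_succ_of_pow_eq_zero h1 (hnil c l hc)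
      (by have := pow_pos hpp i; omega)
  have hmem : ∀ u ∈ Subgroup.closure ({a, b, c} : Set A), o u - 1 ∈ J := by
    intro u hu
    induction hu using Subgroup.closure_induction with
    | mem u hu =>
      have h0 : o u - 1 ∈ I u := Ideal.subset_span rfl
      rcases hu with rfl | rfl | rfl
      · exact (le_sup_left.trans le_sup_left : I u ≤ I u ⊔ I b ⊔ I c) h0
      · exact (le_sup_right.trans le_sup_left : I u ≤ I a ⊔ I u ⊔ I c) h0
      · exact (le_sup_right : I u ≤ I a ⊔ I b ⊔ I u) h0
    | one => simp
    | mul u v _ _ hu hv =>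
      have : o (u * v) - 1 = o u * (o v - 1) + (o u - 1) := by rw [map_mul]; ring
      rw [this]
      exact J.add_mem (J.mul_mem_left _ hv) hu
    | inv u _ hu =>
      have : o u⁻¹ - 1 = -(o u⁻¹ * (o u - 1)) := by
        rw [mul_sub, ← map_mul]; simp
      rw [this]
      exact J.neg_mem (J.mul_mem_left _ hu)
  have hprod : ∀ S : List α, (S.map fun s => 1 - o (f s)).prod ∈ J ^ S.length := by
    intro S
    induction S with
    | nil => simp
    | cons s S ih =>
      rw [List.map_cons, List.prod_cons, List.length_cons, pow_succ']
      refine Ideal.mul_mem_mul ?_ ih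
      rw [← neg_sub]
      exact J.neg_mem (hmem _ (hf s))
  let W : List α → Set A := fun S => {g | ∃ T : List α, T ≠ [] ∧ T.Sublist S ∧ (T.map f).prod = g}
  have hspan : ∀ S : List α,
      (S.map fun s => 1 - o (f s)).prod - 1 ∈ Submodule.span (ZMod p) (o '' W S) := by
    intro S
    induction S with
    | nil => simp
    | cons s S ih =>
      have hsub : o '' W S ⊆ o '' W (s :: S) :=
        Set.image_mono fun g ⟨T, h1, h2, h3⟩ => ⟨T, h1, h2.cons _, h3⟩
      have hmul : Submodule.span (ZMod p) (o '' W S) ≤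
          (Submodule.span (ZMod p) (o '' W (s :: S))).comap
            (LinearMap.mulLeft (ZMod p) (o (f s))) := by
        rw [Submodule.span_le]
        rintro _ ⟨_, ⟨T, h1, h2, rfl⟩, rfl⟩
        refine Submodule.subset_span ⟨_, ⟨s :: T, by simp, h2.cons_cons s, rfl⟩, ?_⟩
        simp
      have e : ((s :: S).map fun s => 1 - o (f s)).prod - 1 =
          ((S.map fun s => 1 - o (f s)).prod - 1)
            - o (f s) * ((S.map fun s => 1 - o (f s)).prod - 1) - o (f s) := by
        rw [List.map_cons, List.prod_cons]; ring
      rw [e]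
      refine sub_mem (sub_mem (Submodule.span_mono hsub ih) (hmul ih)) ?_
      exact Submodule.subset_span ⟨_, ⟨[s], by simp, by simp, by simp⟩, rfl⟩
  have h0 := hspan S
  have hz := hprod S
  rw [hJ _ hS] at hz
  rw [Ideal.zero_eq_bot, Ideal.mem_bot] at hz
  rw [hz, zero_sub, neg_mem_iff, ← map_one o] at h0
  exact (MonoidAlgebra.of_mem_span_of_iff (R := ZMod p) (m := 1) (s := W S)).1 h0

theorem exists_sublist_prod_eq_one_of_card_le {A α : Type*} [Group A] [Finite A] (K : Subgroup A)
    (f : α → A) (S : List α) (hS : ∀ s ∈ S, f s ∈ K) (hK : Nat.card K ≤ S.length) :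
    ∃ T : List α, T ≠ [] ∧ T.Sublist S ∧ T.length ≤ Nat.card K ∧ (T.map f).prod = 1 := by
  let F : Fin (Nat.card K + 1) → K := fun i =>
    ⟨((S.take i).map f).prod, K.list_prod_mem fun a ha => by
      obtain ⟨s, hs, rfl⟩ := List.mem_map.1 ha
      exact hS s (List.mem_of_mem_take hs)⟩
  have hF : ¬ Function.Injective F := fun h => by
    have := Nat.card_le_card_of_injective F h
    simp at this
  obtain ⟨i, j, hij, hlt⟩ : ∃ i j, F i = F j ∧ i < j := by
    simp only [Function.Injective, not_forall] at hF
    obtain ⟨i, j, hij, hne⟩ := hF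
    rcases lt_or_gt_of_ne hne with h | h
    · exact ⟨i, j, hij, h⟩
    · exact ⟨j, i, hij.symm, h⟩
  have hj : (j : ℕ) ≤ Nat.card K := by omega
  have hlt' : (i : ℕ) < j := hlt
  refine ⟨(S.take j).drop i, ?_, (List.drop_sublist _ _).trans (List.take_sublist _ _), ?_, ?_⟩
  · intro h
    have := congrArg List.length h
    simp at this
    omega
  · simp
    omega
  · have h1 : ((S.take i).map f).prod = ((S.take j).map f).prod := congrArg Subtype.val hij
    have h2 : S.take j = S.take i ++ (S.take j).drop i := by
      conv_lhs => rw [← List.take_append_drop i (S.take j)]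
      rw [List.take_take, min_eq_left hlt'.le]
    rw [h2, List.map_append, List.prod_append] at h1
    simpa using h1

/-- At least `v` elements of the kernel of `π` are products of nonempty subsequences of `M`. -/
def HasKerValues {G Q : Type*} [Group G] [Group Q] (π : G →* Q) (M : Multiset G) (v : ℕ) : Prop :=
  ∃ A : Finset G, v ≤ A.card ∧
    ∀ a ∈ A, π a = 1 ∧ ∃ T : List G, T ≠ [] ∧ (T : Multiset G) ≤ M ∧ T.prod = a

theorem HasKerValues.zero {G Q : Type*} [Group G] [Group Q] (π : G →* Q) (M : Multiset G) :
    HasKerValues π M 0 :=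
  ⟨∅, by simp⟩

open scoped Pointwise in
theorem HasKerValues.add {G Q : Type*} [Group G] [Group Q] {π : G →* Q} {M C : Multiset G}
    {p v c : ℕ} (hp : p ≤ Monoid.minOrder G) (hM : HasKerValues π M v) (hC : HasKerValues π C c)
    (hc : 0 < c) (hone : ∀ T : List G, T ≠ [] → (T : Multiset G) ≤ M → T.prod ≠ 1)
    (hvc : v + c ≤ p) : HasKerValues π (C + M) (v + c) := by
  classical
  obtain ⟨A, hA, hA'⟩ := hM
  obtain ⟨B, hB, hB'⟩ := hC
  have h1 : (1 : G) ∉ A := fun h => by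
    obtain ⟨-, T, hT, hTM, hT1⟩ := hA' 1 h
    exact hone T hT hTM hT1
  refine ⟨B * insert 1 A, ?_, ?_⟩
  · have hcd := cauchy_davenport_minOrder_mul (Finset.card_pos.1 (hc.trans_le hB))
      (Finset.insert_nonempty 1 A)
    rw [Finset.card_insert_of_notMem h1] at hcd
    have : ((v + c : ℕ) : ℕ∞) ≤ ((B * insert 1 A).card : ℕ∞) := by
      refine le_trans (le_min ((Nat.cast_le.2 hvc).trans hp) (Nat.cast_le.2 ?_)) hcd
      omega
    exact_mod_cast this
  · intro a ha
    obtain ⟨b, hb, a', ha', rfl⟩ := Finset.mem_mul.1 ha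
    obtain ⟨hb1, T, hT, hTC, rfl⟩ := hB' b hb
    rcases Finset.mem_insert.1 ha' with rfl | ha'
    · exact ⟨by simpa using hb1, T, hT, hTC.trans (Multiset.le_add_right _ _), by simp⟩
    · obtain ⟨ha1, U, hU, hUM, rfl⟩ := hA' a' ha'
      refine ⟨by rw [map_mul, hb1, ha1, one_mul], T ++ U, by simp [hT], ?_, by simp⟩
      rw [← Multiset.coe_add]
      exact add_le_add hTC hUM

theorem HasKerValues.exists_prod_eq_one {G Q : Type*} [Group G] [Finite G] [Group Q] {π : G →* Q}
    {M : Multiset G} (h : HasKerValues π M (Nat.card π.ker)) :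
    ∃ T : List G, T ≠ [] ∧ (T : Multiset G) ≤ M ∧ T.prod = 1 := by
  obtain ⟨A, hA, hA'⟩ := h
  have hsub : (A : Set G) ⊆ (π.ker : Set G) := fun a ha => (hA' a ha).1
  have heq := Set.eq_of_subset_of_ncard_le hsub (by
    rw [Set.ncard_coe_finset]; exact hA)
  have h1 : (1 : G) ∈ (A : Set G) := by rw [heq]; exact π.ker.one_mem
  exact (hA' 1 h1).2

theorem closure_pair_prod {Q : Type*} [CommGroup Q] {a b : Q}
    (hab : Subgroup.closure ({a, b} : Set Q) = ⊤) (q : Q) :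
    q ∈ Subgroup.closure ({a, b, 1} : Set Q) :=
  Subgroup.closure_mono (by intro u; simp; tauto) (hab ▸ Subgroup.mem_top q)

/-- The Davenport constant of a rank two abelian `p`-group, with a bound on the length. -/
theorem exists_sublist_prod_eq_one_of_closure_pair {Q α : Type*} [CommGroup Q] {p i : ℕ}
    [Fact p.Prime] {a b : Q} (hab : Subgroup.closure ({a, b} : Set Q) = ⊤) (ha : a ^ p ^ i = 1)
    (hb : b ^ p = 1) (f : α → Q) (S : List α) (hS : p ^ i + p ≤ S.length + 1) :
    ∃ T : List α, T ≠ [] ∧ T.Sublist S ∧ T.length + 1 ≤ p ^ i + p ∧ (T.map f).prod = 1 := by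
  obtain ⟨T, hT, hTS, hT1⟩ := nonempty_sublist_prod_eq_one f (c := 1) (j := 1) (l := 0) ha
    (by simpa using hb) (by simp) (fun s => closure_pair_prod hab (f s))
    (S.take (p ^ i + p - 1)) (by simp; omega)
  refine ⟨T, hT, hTS.trans (List.take_sublist _ _), ?_, hT1⟩
  have := hTS.length_le
  have := (Fact.out : p.Prime).pos
  simp at *
  omega

theorem exists_short_sublist_prod_eq_one {Q α : Type*} [CommGroup Q] {p i : ℕ}
    [Fact p.Prime] {a b : Q} (hab : Subgroup.closure ({a, b} : Set Q) = ⊤) (ha : a ^ p ^ i = 1)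
    (hb : b ^ p = 1) (hi : 1 ≤ i) (f : α → Q) (S : List α)
    (hS : 2 * p ^ i + p ≤ S.length + 2) :
    ∃ T : List α, T ≠ [] ∧ (T : Multiset α) ≤ S ∧ T.length ≤ p ^ i ∧ (T.map f).prod = 1 := by
  have hpi : p ≤ p ^ i := Nat.le_self_pow (by omega) p
  have hp2 := (Fact.out : p.Prime).two_le
  let u : Multiplicative (ZMod (p ^ i)) := Multiplicative.ofAdd 1
  obtain ⟨T, hT, hTS, hT1⟩ := nonempty_sublist_prod_eq_one (fun s => (f s, u))
    (a := (a, 1)) (b := (b, 1)) (c := (1, u)) (i := i) (j := 1) (l := i) (p := p)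
    (by simp [ha]) (by simp [hb])
    (by
      refine Prod.ext (by simp) ?_
      change u ^ p ^ i = 1
      rw [← ofAdd_nsmul]; simp)
    (by
      intro s
      have h1 : (f s, (1 : Multiplicative (ZMod (p ^ i)))) ∈
          Subgroup.closure ({(a, 1), (b, 1)} : Set (Q × Multiplicative (ZMod (p ^ i)))) := by
        have h2 : f s ∈ Subgroup.closure ({a, b} : Set Q) := hab ▸ Subgroup.mem_top _
        have h3 := Subgroup.mem_map_of_mem (MonoidHom.inl Q (Multiplicative (ZMod (p ^ i)))) h2
        rw [MonoidHom.map_closure, Set.image_pair] at h3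
        exact h3
      have h4 : (f s, u) = (f s, 1) * (1, u) := by simp
      rw [h4]
      refine mul_mem (Subgroup.closure_mono ?_ h1) (Subgroup.subset_closure (by simp))
      intro v; simp; tauto)
    (S.take (2 * p ^ i + p - 2)) (by simp; omega)
  have hlen := hTS.length_le
  have hTS' : T.Sublist S := hTS.trans (List.take_sublist _ _)
  have hTf : (T.map f).prod = 1 := by
    have := congrArg (MonoidHom.fst _ _) hT1
    rw [map_list_prod, List.map_map] at this
    exact this
  have hdvd : p ^ i ∣ T.length := by
    have := congrArg (MonoidHom.snd _ _) hT1
    rw [map_list_prod, List.map_map] at this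
    have h2 : (MonoidHom.snd Q (Multiplicative (ZMod (p ^ i)))) ∘ (fun s => (f s, u)) =
      fun _ : α => u := rfl
    rw [h2, List.map_const', List.prod_replicate, map_one, ← ofAdd_nsmul, nsmul_one,
      ofAdd_eq_one] at this
    exact (ZMod.natCast_eq_zero_iff _ _).1 this
  by_cases hle : T.length ≤ p ^ i
  · exact ⟨T, hT, Multiset.coe_le.2 hTS'.subperm, hle, hTf⟩
  obtain ⟨n, hn⟩ := hdvd
  have hn2 : n = 2 := by
    simp at hlen
    have : n < 3 := by
      by_contra h
      have : p ^ i * 3 ≤ p ^ i * n := Nat.mul_le_mul_left _ (by omega)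
      omega
    interval_cases n <;> omega
  subst hn2
  obtain ⟨U, hU, hUT, hUl, hU1⟩ :=
    exists_sublist_prod_eq_one_of_closure_pair hab ha hb f T (by omega)
  obtain ⟨V, hV⟩ := hUT.exists_perm_append
  have hVl := hV.length_eq
  rw [List.length_append] at hVl
  by_cases hUs : U.length ≤ p ^ i
  · exact ⟨U, hU, Multiset.coe_le.2 (hUT.trans hTS').subperm, hUs, hU1⟩
  refine ⟨V, ?_, ?_, by omega, ?_⟩
  · rintro rfl
    simp at hVl
    omega
  · refine Multiset.coe_le.2 (List.Subperm.trans ?_ hTS'.subperm)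
    exact (List.sublist_append_right U V).subperm.trans hV.symm.subperm
  · have := (hV.map f).prod_eq
    rw [hTf, List.map_append, List.prod_append, hU1, one_mul] at this
    exact this.symm

theorem commute_of_commute_lifts {G Q : Type*} [Group G] [Group Q] {π : G →* Q}
    (hker : π.ker ≤ Subgroup.center G) {B : List G} (hB : ∀ a ∈ B, ∀ b ∈ B, a * b = b * a)
    (htop : Subgroup.closure (π '' {b | b ∈ B}) = ⊤) (g h : G) : g * h = h * g := by
  have hle : ∀ g : G, g ∈ Subgroup.closure ({b | b ∈ B} ∪ (Subgroup.center G : Set G)) := by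
    intro g
    have hg : π g ∈ (Subgroup.closure {b | b ∈ B}).map π := by
      rw [MonoidHom.map_closure, htop]; exact Subgroup.mem_top _
    obtain ⟨c, hc, hcg⟩ := hg
    have h1 : c⁻¹ * g ∈ π.ker := by
      rw [MonoidHom.mem_ker, map_mul, map_inv, hcg, inv_mul_cancel]
    rw [← mul_inv_cancel_left c g]
    exact mul_mem (Subgroup.closure_mono Set.subset_union_left hc)
      (Subgroup.subset_closure (Or.inr (hker h1)))
  refine Subgroup.closure_induction₂ (p := fun g h _ _ => Commute g h) ?_ ?_ ?_ ?_ ?_ ?_ ?_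
    (hle g) (hle h)
  · rintro a b (ha | ha) (hb | hb)
    · exact hB a ha b hb
    · exact (Subgroup.mem_center_iff.1 hb a)
    · exact (Subgroup.mem_center_iff.1 ha b).symm
    · exact (Subgroup.mem_center_iff.1 hb a)
  · exact fun a _ => Commute.one_left a
  · exact fun a _ => Commute.one_right a
  · exact fun _ _ _ _ _ _ => Commute.mul_left
  · exact fun _ _ _ _ _ _ => Commute.mul_right
  · exact fun _ _ _ _ => Commute.inv_left
  · exact fun _ _ _ _ => Commute.inv_right

theorem exists_block {G Q : Type*} [Group G] [CommGroup Q] {π : G →* Q} {p i : ℕ}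
    [Fact p.Prime] (hker : π.ker ≤ Subgroup.center G) (hnc : ¬ ∀ g h : G, g * h = h * g)
    (hQ : Nat.card Q = p ^ (i + 1)) {a b : Q} (hab : Subgroup.closure ({a, b} : Set Q) = ⊤)
    (ha : a ^ p ^ i = 1) (hb : b ^ p = 1) (R : Multiset G) (hR : p ^ i + p ≤ R.card + 1) :
    ∃ B : Multiset G, B ≤ R ∧ ((B.card ≤ p ^ i ∧ HasKerValues π B 1) ∨
      (B.card + 1 ≤ p ^ i + p ∧ HasKerValues π B 2)) := by
  classical
  have hpp : p.Prime := Fact.out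
  have : Finite Q := Nat.finite_of_card_ne_zero (hQ ▸ (pow_pos hpp.pos _).ne')
  obtain ⟨B, hB, hBR, hBl, hB1⟩ := exists_sublist_prod_eq_one_of_closure_pair hab ha hb π
    R.toList (by simpa using hR)
  have hBR' : (B : Multiset G) ≤ R := by
    conv_rhs => rw [← R.coe_toList]
    exact Multiset.coe_le.2 hBR.subperm
  by_cases hcomm : ∀ a ∈ B, ∀ b ∈ B, a * b = b * a
  · obtain ⟨C, hC, hCB, hCl, hC1⟩ : ∃ C : List G, C ≠ [] ∧ C.Sublist B ∧ C.length ≤ p ^ i ∧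
        (C.map π).prod = 1 := by
      by_cases hle : B.length ≤ p ^ i
      · exact ⟨B, hB, List.Sublist.refl _, hle, hB1⟩
      let K : Subgroup Q := Subgroup.closure (π '' {b | b ∈ B})
      have hKne : K ≠ ⊤ := fun h => hnc (commute_of_commute_lifts hker hcomm h)
      have hKcard : Nat.card K ≤ p ^ i := by
        obtain ⟨n, hn, hKn⟩ := (Nat.dvd_prime_pow hpp).1 (hQ ▸ Subgroup.card_subgroup_dvd_card K)
        have : n ≠ i + 1 := by
          rintro rfl
          exact hKne ((Subgroup.card_eq_iff_eq_top K).1 (hKn.trans hQ.symm))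
        rw [hKn]
        exact Nat.pow_le_pow_right hpp.pos (by omega)
      obtain ⟨C, h1, h2, h3, h4⟩ := exists_sublist_prod_eq_one_of_card_le K π B
        (fun s hs => Subgroup.subset_closure ⟨s, hs, rfl⟩) (by omega)
      exact ⟨C, h1, h2, h3.trans hKcard, h4⟩
    refine ⟨C, (Multiset.coe_le.2 hCB.subperm).trans hBR', Or.inl ⟨hCl, {C.prod}, by simp, ?_⟩⟩
    simp only [Finset.mem_singleton, forall_eq]
    exact ⟨by rw [map_list_prod, hC1], C, hC, le_rfl, rfl⟩
  · push Not at hcomm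
    obtain ⟨u, hu, v, hv, huv⟩ := hcomm
    have hne : v ≠ u := fun h => huv (by rw [h])
    have hp1 : B.Perm (u :: v :: (B.erase u).erase v) :=
      (List.perm_cons_erase hu).trans
        ((List.perm_cons_erase ((List.mem_erase_of_ne hne).2 hv)).cons u)
    have hp2 : B.Perm (v :: u :: (B.erase u).erase v) := hp1.trans (List.Perm.swap _ _ _)
    refine ⟨B, hBR', Or.inr ⟨hBl, {(u :: v :: (B.erase u).erase v).prod,
      (v :: u :: (B.erase u).erase v).prod}, ?_, ?_⟩⟩
    · rw [Finset.card_pair]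
      simp only [List.prod_cons, ← mul_assoc]
      exact fun h => huv (mul_right_cancel h)
    · have key : ∀ L : List G, B.Perm L → π L.prod = 1 ∧
          ∃ T : List G, T ≠ [] ∧ (T : Multiset G) ≤ (B : Multiset G) ∧ T.prod = L.prod := by
        intro L hL
        refine ⟨?_, L, fun h => hB ?_, Multiset.coe_le.2 hL.symm.subperm, rfl⟩
        · rw [map_list_prod, ← (hL.map π).prod_eq, hB1]
        · rw [h] at hL; exact hL.eq_nil
      intro w hw
      rcases Finset.mem_insert.1 hw with rfl | hw
      · exact key _ hp1
      · rw [Finset.mem_singleton.1 hw]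
        exact key _ hp2

theorem exists_prod_eq_one_card_le {G Q : Type*} [Group G] [Finite G] [CommGroup Q] {π : G →* Q}
    {p i : ℕ} [Fact p.Prime] (hp3 : 3 ≤ p) (hi : 1 ≤ i) (hord : p ≤ Monoid.minOrder G)
    (hker : π.ker ≤ Subgroup.center G) (hkc : Nat.card π.ker = p)
    (hnc : ¬ ∀ g h : G, g * h = h * g)
    (hQ : Nat.card Q = p ^ (i + 1)) {a b : Q} (hab : Subgroup.closure ({a, b} : Set Q) = ⊤)
    (ha : a ^ p ^ i = 1) (hb : b ^ p = 1) (S : Multiset G) (hS : S.card + 1 = p ^ (i + 1) + p) :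
    ∃ T : List G, T ≠ [] ∧ (T : Multiset G) ≤ S ∧ T.length ≤ p ^ (i + 1) ∧ T.prod = 1 := by
  classical
  by_contra! hno
  have hpi : p ≤ p ^ i := Nat.le_self_pow (by omega) p
  rw [pow_succ'] at hS hno
  set m := p ^ i with hm
  have h3m : 3 * m ≤ p * m := Nat.mul_le_mul_right m hp3
  have hone : ∀ M ≤ S, M.card ≤ p * m →
      ∀ T : List G, T ≠ [] → (T : Multiset G) ≤ M → T.prod ≠ 1 := by
    intro M hM hMc T hT hTM
    refine hno T hT (hTM.trans hM) ?_
    have := Multiset.card_le_card hTM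
    simp at this
    omega
  have hfew : ∀ M ≤ S, M.card ≤ p * m → ¬ HasKerValues π M p := by
    intro M hM hMc h
    rw [← hkc] at h
    obtain ⟨T, hT, hTM, hT1⟩ := h.exists_prod_eq_one
    exact hone M hM hMc T hT hTM hT1
  obtain ⟨B, hB, hBS, hBl, hB1⟩ := exists_short_sublist_prod_eq_one hab ha hb hi π S.toList
    (by rw [Multiset.length_toList]; omega)
  rw [S.coe_toList] at hBS
  have hBc : (B : Multiset G).card ≤ m := by simpa using hBl
  have hBv : HasKerValues π (B : Multiset G) 1 := by
    refine ⟨{B.prod}, by simp, ?_⟩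
    simp only [Finset.mem_singleton, forall_eq]
    exact ⟨by rw [map_list_prod, hB1], B, hB, le_rfl, rfl⟩
  have hSB : (S - (B : Multiset G)).card + (B : Multiset G).card = S.card := by
    rw [← Multiset.card_add, Multiset.sub_add_cancel hBS]
  have claim : ∀ v, v + 1 ≤ p → ∃ M ≤ S - (B : Multiset G), ∃ w, v ≤ w ∧ w ≤ v + 1 ∧
      HasKerValues π M w ∧ M.card ≤ w * m := by
    intro v
    induction v with
    | zero => exact fun _ => ⟨0, Multiset.zero_le _, 0, le_rfl, by omega, .zero _ _, by simp⟩
    | succ v ih =>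
      intro hv
      obtain ⟨M, hM, w, hw1, hw2, hMw, hMc⟩ := ih (by omega)
      obtain rfl | rfl : w = v ∨ w = v + 1 := by omega
      swap
      · exact ⟨M, hM, v + 1, le_rfl, by omega, hMw, hMc⟩
      have hsub : (S - (B : Multiset G) - M).card + M.card = (S - (B : Multiset G)).card := by
        rw [← Multiset.card_add, Multiset.sub_add_cancel hM]
      have hwm : (w + 2) * m ≤ p * m := Nat.mul_le_mul_right m hv
      rw [add_mul] at hwm
      obtain ⟨C, hC, hC'⟩ := exists_block hker hnc hQ hab ha hb (S - (B : Multiset G) - M)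
        (by omega)
      have hCM : C + M ≤ S - (B : Multiset G) := by
        rw [← Multiset.sub_add_cancel hM]
        exact add_le_add hC le_rfl
      have hM1 := hone M (hM.trans (Multiset.sub_le_self _ _)) (by omega)
      rcases hC' with ⟨hCc, hCv⟩ | ⟨hCc, hCv⟩
      · refine ⟨C + M, hCM, w + 1, le_rfl, by omega, hMw.add hord hCv one_pos hM1 (by omega), ?_⟩
        rw [Multiset.card_add, add_mul]
        omega
      · refine ⟨C + M, hCM, w + 2, by omega, by omega, hMw.add hord hCv two_pos hM1 (by omega), ?_⟩
        rw [Multiset.card_add, add_mul]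
        omega
  obtain ⟨M, hM, w, hw1, hw2, hMw, hMc⟩ := claim (p - 1) (by omega)
  have hMS : M ≤ S := hM.trans (Multiset.sub_le_self _ _)
  obtain rfl | hw : w = p ∨ w + 1 = p := by omega
  · exact hfew M hMS hMc hMw
  · have hpm : p * m = w * m + m := by rw [← hw]; ring
    refine hfew ((B : Multiset G) + M) ?_ ?_ ?_
    · rw [← Multiset.sub_add_cancel hBS, add_comm]
      exact add_le_add hM le_rfl
    · rw [Multiset.card_add]
      omega
    · rw [← hw]
      exact hMw.add hord hBv one_pos (hone M hMS (by omega)) hw.le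

theorem dvd_sub_one_of_orderOf_eq {p i g : ℕ} (hp : p.Prime) (hpo : Odd p)
    (hg : orderOf (g : ZMod (p ^ (i + 1))) = p) : ((p ^ i : ℕ) : ℤ) ∣ (g : ℤ) - 1 := by
  have := Fact.mk hp
  have h1 : ((p ^ (i + 1) : ℕ) : ℤ) ∣ (g : ℤ) ^ p - 1 := by
    rw [← ZMod.intCast_zmod_eq_zero_iff_dvd]
    have := pow_orderOf_eq_one (g : ZMod (p ^ (i + 1)))
    rw [hg] at this
    push_cast at this ⊢
    rw [this, sub_self]
  have h2 : (p : ℤ) ∣ (g : ℤ) - 1 := by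
    have h3 : (p : ℤ) ∣ (g : ℤ) ^ p - 1 := (Int.natCast_dvd_natCast.2
      (dvd_pow_self p (Nat.succ_ne_zero i))).trans h1
    rw [← ZMod.intCast_zmod_eq_zero_iff_dvd] at h3 ⊢
    push_cast at h3 ⊢
    rwa [ZMod.pow_card] at h3
  have h4 : ¬ (p : ℤ) ∣ (g : ℤ) := fun h => by
    have h5 : (p : ℤ) ∣ 1 := by simpa using dvd_sub h h2
    exact hp.one_lt.ne' (by exact_mod_cast Int.eq_one_of_dvd_one (by positivity) h5)
  have h6 := Int.emultiplicity_pow_sub_pow hp hpo (x := g) (y := 1) h2 h4 p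
  rw [one_pow] at h6
  have h7 : emultiplicity p p = 1 := by
    simpa using emultiplicity_pow_self_of_prime hp.prime 1
  rw [h7] at h6
  push_cast at h1 ⊢
  rw [pow_dvd_iff_le_emultiplicity] at h1 ⊢
  rw [h6] at h1
  push_cast at h1
  exact (ENat.add_le_add_iff_right (by simp)).1 h1

theorem commute_of_closure_pair {G : Type*} [Group G] {x y : G}
    (hgen : Subgroup.closure ({x, y} : Set G) = ⊤) (hxy : Commute x y) (g h : G) : Commute g h := by
  have hmem : ∀ g : G, g ∈ Subgroup.closure ({x, y} : Set G) := fun g => hgen ▸ Subgroup.mem_top g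
  refine Subgroup.closure_induction₂ (p := fun g h _ _ => Commute g h) ?_ ?_ ?_ ?_ ?_ ?_ ?_
    (hmem g) (hmem h)
  · rintro a b (rfl | rfl) (rfl | rfl)
    exacts [Commute.refl _, hxy, hxy.symm, Commute.refl _]
  · exact fun a _ => Commute.one_left a
  · exact fun a _ => Commute.one_right a
  · exact fun _ _ _ _ _ _ => Commute.mul_left
  · exact fun _ _ _ _ _ _ => Commute.mul_right
  · exact fun _ _ _ _ => Commute.inv_left
  · exact fun _ _ _ _ => Commute.inv_right

theorem le_minOrder_of_card_eq_prime_pow {G : Type*} [Group G] {p n : ℕ} (hp : p.Prime)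
    (hG : Nat.card G = p ^ n) : p ≤ Monoid.minOrder G := by
  refine Monoid.le_minOrder.2 fun a ha _ => ?_
  obtain ⟨j, -, hj⟩ := (Nat.dvd_prime_pow hp).1 (hG ▸ orderOf_dvd_natCard a)
  have hj0 : j ≠ 0 := by
    rintro rfl
    exact ha (orderOf_eq_one_iff.1 (by simpa using hj))
  rw [hj]
  exact_mod_cast Nat.le_self_pow hj0 p

theorem map_prod_eq_pow_count {G H : Type*} [Group G] [DecidableEq G] [Group H] (φ : G →* H)
    {x y : G} (hx : φ x = 1) (hxy : x ≠ y) (l : List G) (hl : ∀ a ∈ l, a = x ∨ a = y) :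
    φ l.prod = φ y ^ l.count y := by
  induction l with
  | nil => simp
  | cons a l ih =>
    have := ih fun b hb => hl b (List.mem_cons_of_mem _ hb)
    rcases hl a List.mem_cons_self with rfl | rfl
    · rw [List.prod_cons, map_mul, hx, one_mul, this, List.count_cons_of_ne hxy]
    · rw [List.prod_cons, map_mul, this, List.count_cons_self, pow_succ']

/-- A product-one subsequence of `x^[a] y^[p-1]` has no term `y` and a multiple of `orderOf x`
terms `x`. -/
theorem length_of_isProdOne_sublist {G H : Type*} [Group G] [Group H] {φ : G →* H} {x y : G}
    {a p : ℕ} (hp : 0 < p) (hx : φ x = 1) (hy : orderOf (φ y) = p) (hxy : x ≠ y) {T : List G}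
    (hT : T.Sublist (List.replicate a x ++ List.replicate (p - 1) y)) (h1 : IsProdOne T) :
    T.length ≤ a ∧ orderOf x ∣ T.length := by
  classical
  obtain ⟨T₁, T₂, rfl, hT₁, hT₂⟩ := List.sublist_append_iff.1 hT
  obtain ⟨i, hi, rfl⟩ := List.sublist_replicate_iff.1 hT₁
  obtain ⟨j, hj, rfl⟩ := List.sublist_replicate_iff.1 hT₂
  obtain ⟨l, hl, hl1⟩ := h1
  have hmem : ∀ b ∈ l, b = x ∨ b = y := by
    intro b hb
    rcases List.mem_append.1 (hl.mem_iff.1 hb) with hb | hb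
    · exact Or.inl (List.eq_of_mem_replicate hb)
    · exact Or.inr (List.eq_of_mem_replicate hb)
  have hcount := map_prod_eq_pow_count φ hx hxy l hmem
  have hlj : l.count y = j := by
    rw [hl.count_eq, List.count_append, List.count_replicate_self,
      List.count_eq_zero_of_not_mem, zero_add]
    exact fun h => hxy (List.eq_of_mem_replicate h).symm
  rw [hl1, map_one, hlj] at hcount
  have hdvd := orderOf_dvd_of_pow_eq_one hcount.symm
  rw [hy] at hdvd
  obtain rfl : j = 0 := Nat.eq_zero_of_dvd_of_lt hdvd (by omega)
  rw [List.replicate_zero, List.append_nil] at hl ⊢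
  rw [List.perm_replicate.1 hl, List.prod_replicate] at hl1
  rw [List.length_replicate]
  exact ⟨hi, orderOf_dvd_of_pow_eq_one hl1⟩

/-- For an odd prime `p`, `k > 1`, and `G = Z_p ⋉ Z_{p^k}` (with `ord_{p^k}(g) = p`),
`d(G) = p^k + p - 1` and `f(G) = p^k`. -/
theorem df_ppower (p k g : ℕ) (hp : p.Prime) (hpo : Odd p) (hk : 1 < k)
    (hg : orderOf (g : ZMod (p ^ k)) = p)
    (G : Type*) [Group G] [Finite G] (x y : G)
    (hordx : orderOf x = p ^ k) (hordy : orderOf y = p)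
    (hrel : x ^ g * y = y * x)
    (hgen : Subgroup.closure ({x, y} : Set G) = ⊤) :
    dC G = p ^ k + p - 1 ∧ fC G = p ^ k := by
  classical
  have := Fact.mk hp
  obtain ⟨i, rfl⟩ : ∃ i, k = i + 1 := ⟨k - 1, by omega⟩
  have hi : 1 ≤ i := by omega
  have hp3 : 3 ≤ p := by
    have := hp.two_le
    have : p ≠ 2 := by rintro rfl; exact absurd hpo (by decide)
    omega
  have hgd := dvd_sub_one_of_orderOf_eq hp hpo hg
  have hncxy : ¬ Commute x y := by
    intro h
    have h1 : x ^ g = x ^ 1 := by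
      rw [pow_one]
      exact mul_right_cancel (hrel.trans h.eq.symm)
    rw [pow_eq_pow_iff_modEq, hordx] at h1
    have h2 : (g : ZMod (p ^ (i + 1))) = 1 := by
      simpa using (ZMod.natCast_eq_natCast_iff _ _ _).2 h1
    rw [h2, orderOf_one] at hg
    omega
  have hxy : x ≠ y := fun h => hncxy (h ▸ Commute.refl _)
  -- the derived subgroup
  let z : G := x ^ p ^ i
  have hzord : orderOf z = p := by
    rw [orderOf_pow_of_dvd (pow_pos hp.pos _).ne' (hordx ▸ pow_dvd_pow p (Nat.le_succ i)), hordx,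
      Nat.pow_div (Nat.le_succ i) hp.pos]
    simp
  have hyz : Commute y z := by
    have h1 : SemiconjBy y x (x ^ g) := hrel.symm
    have h2 := h1.pow_right (p ^ i)
    have h3 : (x ^ g) ^ p ^ i = x ^ p ^ i := by
      rw [← pow_mul, pow_eq_pow_iff_modEq, hordx]
      refine (Nat.modEq_iff_dvd.2 ?_).symm
      push_cast
      rw [pow_succ', ← sub_one_mul]
      refine mul_dvd_mul_right (dvd_trans ?_ hgd) _
      exact_mod_cast dvd_pow_self p (by omega)
    rw [h3] at h2
    exact h2
  have hzc : z ∈ Subgroup.center G := by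
    rw [Subgroup.mem_center_iff]
    intro h
    have hle : Subgroup.closure ({x, y} : Set G) ≤ Subgroup.centralizer {z} := by
      rw [Subgroup.closure_le]
      rintro a (rfl | rfl)
      · exact Subgroup.mem_centralizer_singleton_iff.2 (Commute.self_pow _ _).eq
      · exact Subgroup.mem_centralizer_singleton_iff.2 hyz.eq
    exact Subgroup.mem_centralizer_singleton_iff.1 (hle (hgen ▸ Subgroup.mem_top h))
  let N : Subgroup G := Subgroup.zpowers z
  have hNc : N ≤ Subgroup.center G := by
    rw [Subgroup.zpowers_le]; exact hzc
  have hNn : N.Normal := ⟨fun n hn h => by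
    rwa [Subgroup.mem_center_iff.1 (hNc hn) h, mul_inv_cancel_right]⟩
  let π : G →* G ⧸ N := QuotientGroup.mk' N
  have hab : Subgroup.closure ({π x, π y} : Set (G ⧸ N)) = ⊤ := by
    rw [← Set.image_pair, ← MonoidHom.map_closure, hgen, ← MonoidHom.range_eq_map,
      MonoidHom.range_eq_top]
    exact QuotientGroup.mk'_surjective N
  have hπz : π z = 1 := (QuotientGroup.eq_one_iff z).2 (Subgroup.mem_zpowers z)
  have hπxi : π x ^ p ^ i = 1 := by rw [← map_pow]; exact hπz
  have hπy : π y ^ p = 1 := by rw [← map_pow, ← hordy, pow_orderOf_eq_one, map_one]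
  have hcomm : ∀ a b : G ⧸ N, Commute a b := by
    refine commute_of_closure_pair hab ?_
    have h1 : π x ^ g = π x := by
      have h2 : π x ^ ((g : ℤ) - 1) = 1 := by
        obtain ⟨c, hc⟩ := hgd
        rw [hc, zpow_mul, zpow_natCast, hπxi, one_zpow]
      rwa [zpow_sub_one, zpow_natCast, mul_inv_eq_one] at h2
    have h3 := congrArg π hrel
    rwa [map_mul, map_mul, map_pow, h1] at h3
  let instQ : CommGroup (G ⧸ N) :=
    { (inferInstance : Group (G ⧸ N)) with mul_comm := fun a b => (hcomm a b).eq }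
  -- the quotient by the cyclic subgroup generated by `x`
  let X : Subgroup G := Subgroup.zpowers x
  have hNX : N ≤ X := by
    rw [Subgroup.zpowers_le]; exact pow_mem (Subgroup.mem_zpowers x) _
  have hXn : X.Normal := ⟨fun n hn h => by
    have h1 : h * n * h⁻¹ * n⁻¹ ∈ N := by
      rw [← QuotientGroup.eq_one_iff]
      change π _ = 1
      rw [map_mul, map_mul, map_mul, map_inv, map_inv, (hcomm (π h) (π n)).eq]
      group
    simpa using mul_mem (hNX h1) hn⟩
  let φ : G →* G ⧸ X := QuotientGroup.mk' X
  have hφx : φ x = 1 := (QuotientGroup.eq_one_iff x).2 (Subgroup.mem_zpowers x)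
  have hφy : orderOf (φ y) = p := by
    refine orderOf_eq_prime (by rw [← map_pow, ← hordy, pow_orderOf_eq_one, map_one]) fun h => ?_
    obtain ⟨n, rfl⟩ := Subgroup.mem_zpowers_iff.1 ((QuotientGroup.eq_one_iff y).1 h)
    exact hncxy ((Commute.refl x).zpow_right n)
  have hXidx : Nat.card (G ⧸ X) = p := by
    have h1 : Subgroup.zpowers (φ y) = ⊤ := by
      rw [eq_top_iff, ← MonoidHom.range_eq_top.2 (QuotientGroup.mk'_surjective X),
        MonoidHom.range_eq_map, ← hgen, MonoidHom.map_closure, Set.image_pair, Subgroup.closure_le]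
      rintro a (rfl | rfl)
      · change φ x ∈ _
        rw [hφx]; exact one_mem _
      · exact Subgroup.mem_zpowers (φ y)
    rw [← hφy, ← Nat.card_zpowers, h1, Subgroup.card_top]
  have hGcard : Nat.card G = p ^ (i + 2) := by
    rw [Subgroup.card_eq_card_quotient_mul_card_subgroup X, hXidx, Nat.card_zpowers, hordx]
    ring
  have hQcard : Nat.card (G ⧸ N) = p ^ (i + 1) := by
    have h1 := Subgroup.card_eq_card_quotient_mul_card_subgroup N
    rw [hGcard, Nat.card_zpowers, hzord, pow_succ] at h1
    exact (Nat.eq_of_mul_eq_mul_right hp.pos h1).symm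
  have hπker : π.ker = N := QuotientGroup.ker_mk' N
  have upper : ∀ S : List G, S.length = p ^ (i + 1) + p - 1 →
      ∃ T : List G, T ≠ [] ∧ T.Sublist S ∧ T.length ≤ p ^ (i + 1) ∧ IsProdOne T := by
    intro S hS
    obtain ⟨T, hT, hTS, hTl, hT1⟩ := exists_prod_eq_one_card_le (Q := G ⧸ N) (π := π) hp3 hi
      (le_minOrder_of_card_eq_prime_pow hp hGcard) (hπker.trans_le hNc)
      (by rw [hπker, Nat.card_zpowers, hzord]) (fun h => hncxy (h x y)) hQcard hab hπxi hπy
      (S : Multiset G) (by simp; omega)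
    obtain ⟨U, hUT, hUS⟩ := Multiset.coe_le.1 hTS
    refine ⟨U, ?_, hUS, hUT.length_eq ▸ hTl, T, hUT.symm, hT1⟩
    rintro rfl
    exact hT hUT.symm.eq_nil
  have lower : ∀ (a : ℕ) (T : List G),
      T.Sublist (List.replicate a x ++ List.replicate (p - 1) y) → IsProdOne T →
      T.length ≤ a ∧ p ^ (i + 1) ∣ T.length := fun a T hT h1 =>
    hordx ▸ length_of_isProdOne_sublist hp.pos hφx hφy hxy hT h1
  have hpk : 0 < p ^ (i + 1) := pow_pos hp.pos _
  have hd : dC G = p ^ (i + 1) + p - 1 := by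
    refine le_antisymm (Nat.sInf_le ⟨by omega, fun S hS => ?_⟩)
      (le_csInf ⟨p ^ (i + 1) + p - 1, by omega, fun S hS => ?_⟩ ?_)
    · obtain ⟨T, h1, h2, -, h3⟩ := upper S hS
      exact ⟨T, h1, h2, h3⟩
    · obtain ⟨T, h1, h2, -, h3⟩ := upper S hS
      exact ⟨T, h1, h2, h3⟩
    · rintro m ⟨-, hm⟩
      by_contra! hlt
      obtain ⟨T, hT, hTS, hT1⟩ := hm
        ((List.replicate (p ^ (i + 1) - 1) x ++ List.replicate (p - 1) y).take m)
        (by simp; omega)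
      obtain ⟨h1, h2⟩ := lower _ T (hTS.trans (List.take_sublist _ _)) hT1
      have := Nat.le_of_dvd (List.length_pos_iff.2 hT) h2
      omega
  refine ⟨hd, le_antisymm (Nat.sInf_le ⟨hpk, hd ▸ upper⟩)
    (le_csInf ⟨p ^ (i + 1), hpk, hd ▸ upper⟩ ?_)⟩
  rintro m ⟨-, hm⟩
  obtain ⟨T, hT, hTS, hTm, hT1⟩ := hm
    (List.replicate (p ^ (i + 1)) x ++ List.replicate (p - 1) y) (by rw [hd]; simp; omega)
  exact (Nat.le_of_dvd (List.length_pos_iff.2 hT) (lower _ T hTS hT1).2).trans hTm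
end
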